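/- Let n ≥ 1 and suppose the cluster pattern with initial seed (B, (u_1,…,u_n)) is of type A_n. Then for every cluster (y_1,…,y_n) of the pattern, the denominator vectors den(y_1), …, den(y_n), taken with respect to the initial cluster (u_1,…,u_n), are linearly independent over ℚ; in particular they form a basis of ℚ^n. -/

import Mathlib

open MvPolynomial Matrix

noncomputable section

/-- The ambient field `ℚ(u_1, …, u_n)`. -/
abbrev CAField (n : ℕ) : Type := FractionRing (MvPolynomial (Fin n) ℚ)

/-- The initial cluster variables `u_i`. -/
def uVar (n : ℕ) (i : Fin n) : CAField n :=
  algebraMap (MvPolynomial (Fin n) ℚ) (CAField n) (X i)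

/-- Fomin–Zelevinsky matrix mutation in direction `k`. -/
def mutMat {n : ℕ} (k : Fin n) (B : Matrix (Fin n) (Fin n) ℤ) :
    Matrix (Fin n) (Fin n) ℤ := fun i j =>
  if i = k ∨ j = k then -B i j
  else B i j + (B i k).sign * max (B i k * B k j) 0

/-- Seed mutation in direction `k`: the matrix mutates by `mutMat` and the
`k`-th cluster variable `x_k` is replaced by
`(∏ x_i^{[B_ik]_+} + ∏ x_i^{[-B_ik]_+}) / x_k`. -/
def mutSeed {n : ℕ} (k : Fin n)
    (s : Matrix (Fin n) (Fin n) ℤ × (Fin n → CAField n)) :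
    Matrix (Fin n) (Fin n) ℤ × (Fin n → CAField n) :=
  (mutMat k s.1,
    Function.update s.2 k
      ((∏ i, s.2 i ^ (s.1 i k).toNat + ∏ i, s.2 i ^ (-(s.1 i k)).toNat) / s.2 k))

/-- The seeds of the cluster pattern with initial exchange matrix `B₀` and
initial cluster `(u_1, …, u_n)`: all seeds reachable from the initial seed
by finite sequences of mutations. -/
def IsSeed {n : ℕ} (B₀ : Matrix (Fin n) (Fin n) ℤ)
    (s : Matrix (Fin n) (Fin n) ℤ × (Fin n → CAField n)) : Prop :=
  Relation.ReflTransGen (fun a b => ∃ k, b = mutSeed k a) (B₀, uVar n) s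

/-- `B` is skew-symmetrizable: `D * B` is skew-symmetric for some diagonal `D`
with positive integer diagonal entries. -/
def SkewSymmetrizable {n : ℕ} (B : Matrix (Fin n) (Fin n) ℤ) : Prop :=
  ∃ d : Fin n → ℤ, (∀ i, 0 < d i) ∧
    (Matrix.diagonal d * B)ᵀ = -(Matrix.diagonal d * B)

/-- The Cartan counterpart `A(B)` of `B`. -/
def cartanCounterpart {n : ℕ} (B : Matrix (Fin n) (Fin n) ℤ) :
    Matrix (Fin n) (Fin n) ℤ := fun i j => if i = j then 2 else -|B i j|

/-- The Cartan matrix of type `A_n` (with rows and columns indexed by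
`0, …, n-1`): `2` on the diagonal and `-1` in the positions `(i, i±1)`. -/
def cartanA (n : ℕ) : Matrix (Fin n) (Fin n) ℤ := fun i j =>
  if i = j then 2
  else if i.val + 1 = j.val ∨ j.val + 1 = i.val then -1 else 0

/-- The cluster pattern with initial matrix `B₀` is of the finite type with
Cartan matrix `Cmat`: some seed of the pattern has exchange matrix whose
Cartan counterpart equals `Cmat` up to simultaneous permutation of rows and
columns. -/
def PatternOfType {n : ℕ} (Cmat B₀ : Matrix (Fin n) (Fin n) ℤ) : Prop :=
  ∃ s, IsSeed B₀ s ∧ ∃ σ : Equiv.Perm (Fin n),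
    ∀ i j, cartanCounterpart s.1 (σ i) (σ j) = Cmat i j

/-- `d` is the denominator vector of `y` with respect to the cluster `z`:
`y = f(z_1, …, z_n) / ∏ z_i^{d_i}` with `f` an integer polynomial not
divisible by any variable. -/
def IsDenomVec {n : ℕ} (z : Fin n → CAField n) (y : CAField n)
    (d : Fin n → ℤ) : Prop :=
  ∃ f : MvPolynomial (Fin n) ℤ, (∀ i, ¬ X i ∣ f) ∧
    y = MvPolynomial.aeval z f / ∏ i, z i ^ d i


/-! ### Triangulated polygons -/

/-- `(a,b)` is a boundary edge of the polygon with vertices `L,…,R` or one of the chords. -/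
def PE {n : ℕ} (L R : ℤ) (p q : Fin n → ℤ) (a b : ℤ) : Prop :=
  L ≤ a ∧ a < b ∧ b ≤ R ∧ (b = a + 1 ∨ (a = L ∧ b = R) ∨ ∃ j, p j = a ∧ q j = b)

/-- chords `i`, `j` are consecutive sides of a triangle -/
def PPos {n : ℕ} (L R : ℤ) (p q : Fin n → ℤ) (i j : Fin n) : Prop :=
  (q i = p j ∧ PE L R p q (p i) (q j)) ∨ (q i = q j ∧ PE L R p q (p j) (p i)) ∨
    (p i = p j ∧ PE L R p q (q j) (q i))

/-- `p, q` are the endpoints of a triangulation of the polygon with matrix `B`. -/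
structure PInv {n : ℕ} (L R : ℤ) (B : Matrix (Fin n) (Fin n) ℤ) (p q : Fin n → ℤ) : Prop where
  dg : ∀ j, L ≤ p j ∧ p j + 2 ≤ q j ∧ q j ≤ R ∧ (p j = L → q j ≠ R)
  inj : ∀ i j, p i = p j → q i = q j → i = j
  nc : ∀ i j, p i < p j → p j < q i → q i < q j → False
  inn : ∀ k, ∃ t, PE L R p q (p k) t ∧ PE L R p q t (q k)
  out : ∀ k, ∃ t, (PE L R p q (q k) t ∧ PE L R p q (p k) t) ∨
    (PE L R p q t (p k) ∧ PE L R p q t (q k))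
  pos : ∀ i j, PPos L R p q i j → B i j = 1
  neg : ∀ i j, PPos L R p q j i → B i j = -1
  zer : ∀ i j, ¬ PPos L R p q i j → ¬ PPos L R p q j i → B i j = 0

theorem PE.lt {n : ℕ} {L R : ℤ} {p q : Fin n → ℤ} {a b : ℤ} (h : PE L R p q a b) : a < b := h.2.1

theorem PInv.enc {n : ℕ} {L R : ℤ} {B : Matrix (Fin n) (Fin n) ℤ} {p q : Fin n → ℤ}
    (H : PInv L R B p q) {a b c d : ℤ} (h1 : PE L R p q a b) (h2 : PE L R p q c d) :
    ¬ (a < c ∧ c < b ∧ b < d) := by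
  rintro ⟨ha, hb, hc⟩
  obtain ⟨h11, h12, h13, h14⟩ := h1
  obtain ⟨h21, h22, h23, h24⟩ := h2
  rcases h14 with h | h | ⟨i, hi, hi'⟩
  · omega
  · omega
  rcases h24 with h | h | ⟨j, hj, hj'⟩
  · omega
  · omega
  subst hi hi' hj hj'
  exact H.nc i j ha hb hc

theorem PInv.pe {n : ℕ} {L R : ℤ} {B : Matrix (Fin n) (Fin n) ℤ} {p q : Fin n → ℤ}
    (H : PInv L R B p q) (j : Fin n) : PE L R p q (p j) (q j) := by
  have := H.dg j
  exact ⟨this.1, by omega, this.2.2.1, Or.inr (Or.inr ⟨j, rfl, rfl⟩)⟩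

section flip
variable {n : ℕ} {L R : ℤ} {B : Matrix (Fin n) (Fin n) ℤ} {p q : Fin n → ℤ}

theorem PInv.col (H : PInv L R B p q) (k : Fin n) {w x y z : ℤ}
    (hk : p k = w) (hk' : q k = y) (h1 : PE L R p q w x) (h2 : PE L R p q x y)
    (h3 : PE L R p q y z) (h4 : PE L R p q w z) (j : Fin n) :
    (PPos L R p q j k ↔ (p j = x ∧ q j = y) ∨ (p j = w ∧ q j = z)) ∧
    (PPos L R p q k j ↔ (p j = w ∧ q j = x) ∨ (p j = y ∧ q j = z)) := by
  have hj := H.pe j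
  have e1 := @PInv.enc n L R B p q H
  have := h1.lt; have := h2.lt; have := h3.lt; have := h4.lt; have := hj.lt
  unfold PPos
  rw [hk, hk']
  refine ⟨⟨?_, ?_⟩, ⟨?_, ?_⟩⟩
  · rintro (⟨a, b⟩ | ⟨a, b⟩ | ⟨a, b⟩)
    · have := b.lt
      have := e1 b h4
      omega
    · have := b.lt
      have := e1 b h2
      have := e1 h1 hj
      omega
    · have := b.lt
      have := e1 h4 b
      have := e1 hj h3
      omega
  · rintro (⟨a, b⟩ | ⟨a, b⟩)
    · exact Or.inr (Or.inl ⟨b, a ▸ h1⟩)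
    · exact Or.inr (Or.inr ⟨a, b ▸ h3⟩)
  · rintro (⟨a, b⟩ | ⟨a, b⟩ | ⟨a, b⟩)
    · have := b.lt
      have := e1 b h3
      have := e1 h4 hj
      omega
    · have := b.lt
      have := e1 hj h4
      omega
    · have := b.lt
      have := e1 h1 b
      have := e1 hj h2
      omega
  · rintro (⟨a, b⟩ | ⟨a, b⟩)
    · exact Or.inr (Or.inr ⟨a.symm, b ▸ h2⟩)
    · exact Or.inl ⟨a.symm, b ▸ h4⟩

theorem PInv.pe' (H : PInv L R B p q) (k : Fin n) {w x y z : ℤ}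
    (hk : p k = w) (hk' : q k = y) (h1 : PE L R p q w x) (h2 : PE L R p q x y)
    (h3 : PE L R p q y z) (h4 : PE L R p q w z) (a b : ℤ) :
    PE L R (Function.update p k x) (Function.update q k z) a b ↔
      (PE L R p q a b ∧ ¬ (a = w ∧ b = y)) ∨ (a = x ∧ b = z) := by
  have b1 := h1.1; have b2 := h4.2.2.1
  have := h1.lt; have := h2.lt; have := h3.lt; have := h4.lt
  constructor
  · rintro ⟨c1, c2, c3, c4⟩
    by_cases hxz : a = x ∧ b = z
    · exact Or.inr hxz
    refine Or.inl ⟨⟨c1, c2, c3, ?_⟩, ?_⟩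
    · rcases c4 with c | c | ⟨j, c, c'⟩
      · exact Or.inl c
      · exact Or.inr (Or.inl c)
      · by_cases hj : j = k
        · subst hj
          simp at c c'
          omega
        · rw [Function.update_of_ne hj] at c c'
          exact Or.inr (Or.inr ⟨j, c, c'⟩)
    · rintro ⟨rfl, rfl⟩
      rcases c4 with c | c | ⟨j, c, c'⟩
      · omega
      · omega
      · by_cases hj : j = k
        · subst hj
          simp at c c'
          omega
        · rw [Function.update_of_ne hj] at c c'
          exact hj (H.inj j k (by omega) (by omega))
  · rintro (⟨⟨c1, c2, c3, c4⟩, c5⟩ | ⟨rfl, rfl⟩)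
    · refine ⟨c1, c2, c3, ?_⟩
      rcases c4 with c | c | ⟨j, c, c'⟩
      · exact Or.inl c
      · exact Or.inr (Or.inl c)
      · by_cases hj : j = k
        · subst hj
          omega
        · exact Or.inr (Or.inr ⟨j, by rwa [Function.update_of_ne hj],
            by rwa [Function.update_of_ne hj]⟩)
    · exact ⟨by omega, by omega, by omega, Or.inr (Or.inr ⟨k, by simp, by simp⟩)⟩

theorem PInv.pos' (H : PInv L R B p q) (k : Fin n) {w x y z : ℤ}
    (hk : p k = w) (hk' : q k = y) (h1 : PE L R p q w x) (h2 : PE L R p q x y)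
    (h3 : PE L R p q y z) (h4 : PE L R p q w z) (i j : Fin n) (hi : i ≠ k) (hj : j ≠ k) :
    PPos L R (Function.update p k x) (Function.update q k z) i j ↔
      (PPos L R p q i j ∧ ¬ ((p i = w ∧ q i = x ∧ p j = x ∧ q j = y) ∨
        (p i = y ∧ q i = z ∧ p j = w ∧ q j = z))) ∨
      (p i = x ∧ q i = y ∧ p j = y ∧ q j = z) ∨ (p i = w ∧ q i = z ∧ p j = w ∧ q j = x) := by
  have hwy : PE L R p q w y := by
    have := H.pe k
    rwa [hk, hk'] at this
  have ei := H.pe i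
  have ej := H.pe j
  have e1 := @PInv.enc n L R B p q H
  have := h1.lt; have := h2.lt; have := h3.lt; have := h4.lt; have := ei.lt; have := ej.lt
  have := e1 h1 ei; have := e1 ei h1; have := e1 h1 ej; have := e1 ej h1
  have := e1 h2 ei; have := e1 ei h2; have := e1 h2 ej; have := e1 ej h2
  have := e1 h3 ei; have := e1 ei h3; have := e1 h3 ej; have := e1 ej h3
  have := e1 h4 ei; have := e1 ei h4; have := e1 h4 ej; have := e1 ej h4
  have hxz : ¬ PE L R p q x z := fun h => e1 hwy h (by omega)
  unfold PPos
  simp only [H.pe' k hk hk' h1 h2 h3 h4, Function.update_of_ne hi, Function.update_of_ne hj]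
  constructor
  · rintro (⟨a, ⟨b, c⟩ | c⟩ | ⟨a, ⟨b, c⟩ | c⟩ | ⟨a, ⟨b, c⟩ | c⟩)
    · exact Or.inl ⟨Or.inl ⟨a, b⟩, by omega⟩
    · right; omega
    · exact Or.inl ⟨Or.inr (Or.inl ⟨a, b⟩), by omega⟩
    · right; omega
    · exact Or.inl ⟨Or.inr (Or.inr ⟨a, b⟩), by omega⟩
    · right; omega
  · rintro (⟨⟨a, b⟩ | ⟨a, b⟩ | ⟨a, b⟩, c⟩ | c | c)
    · exact Or.inl ⟨a, Or.inl ⟨b, by omega⟩⟩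
    · exact Or.inr (Or.inl ⟨a, Or.inl ⟨b, by omega⟩⟩)
    · exact Or.inr (Or.inr ⟨a, Or.inl ⟨b, by omega⟩⟩)
    · exact Or.inl ⟨by omega, Or.inr (by omega)⟩
    · exact Or.inr (Or.inr ⟨by omega, Or.inr (by omega)⟩)

theorem PInv.pos'k (H : PInv L R B p q) (k : Fin n) {w x y z : ℤ}
    (hk : p k = w) (hk' : q k = y) (h1 : PE L R p q w x) (h2 : PE L R p q x y)
    (h3 : PE L R p q y z) (h4 : PE L R p q w z) (j : Fin n) :
    (PPos L R (Function.update p k x) (Function.update q k z) k j ↔ PPos L R p q j k) ∧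
    (PPos L R (Function.update p k x) (Function.update q k z) j k ↔ PPos L R p q k j) := by
  have hwy : PE L R p q w y := by
    have := H.pe k
    rwa [hk, hk'] at this
  have := h1.lt; have := h2.lt; have := h3.lt; have := h4.lt
  rw [(H.col k hk hk' h1 h2 h3 h4 j).1, (H.col k hk hk' h1 h2 h3 h4 j).2]
  unfold PPos
  simp only [H.pe' k hk hk' h1 h2 h3 h4]
  by_cases hj : j = k
  · subst hj
    simp only [Function.update_self]
    have u1 : ¬ PE L R p q x x := fun h => by have := h.lt; omega
    have u2 : ¬ PE L R p q z z := fun h => by have := h.lt; omega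
    constructor
    · constructor
      · rintro (⟨a, b⟩ | ⟨a, ⟨b, c⟩ | b⟩ | ⟨a, ⟨b, c⟩ | b⟩)
        · omega
        · exact absurd b u1
        · omega
        · exact absurd b u2
        · omega
      · omega
    · constructor
      · rintro (⟨a, b⟩ | ⟨a, ⟨b, c⟩ | b⟩ | ⟨a, ⟨b, c⟩ | b⟩)
        · omega
        · exact absurd b u1
        · omega
        · exact absurd b u2
        · omega
      · omega
  have ej := H.pe j
  have e1 := @PInv.enc n L R B p q H
  have := ej.lt
  have := e1 h1 ej; have := e1 ej h1
  have := e1 h2 ej; have := e1 ej h2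
  have := e1 h3 ej; have := e1 ej h3
  have := e1 h4 ej; have := e1 ej h4
  simp only [Function.update_self, Function.update_of_ne hj]
  refine ⟨⟨?_, ?_⟩, ⟨?_, ?_⟩⟩
  · rintro (⟨a, ⟨b, c⟩ | c⟩ | ⟨a, ⟨b, c⟩ | c⟩ | ⟨a, ⟨b, c⟩ | c⟩)
    · have := b.lt; have := e1 h4 b; omega
    · omega
    · have := b.lt; have := e1 b h4; have := e1 h1 b; have := e1 b hwy; omega
    · omega
    · have := b.lt; have := e1 b h3; have := e1 h4 b; have := e1 hwy b; omega
    · omega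
  · rintro (⟨a, b⟩ | ⟨a, b⟩)
    · exact Or.inr (Or.inr ⟨a.symm, Or.inl ⟨b ▸ h3, by omega⟩⟩)
    · exact Or.inr (Or.inl ⟨b.symm, Or.inl ⟨a ▸ h1, by omega⟩⟩)
  · rintro (⟨a, ⟨b, c⟩ | c⟩ | ⟨a, ⟨b, c⟩ | c⟩ | ⟨a, ⟨b, c⟩ | c⟩)
    · have := b.lt; have := e1 b h4; have := e1 h4 b; have := e1 hwy b; omega
    · omega
    · have := b.lt; have := e1 b h3; have := e1 h2 b; have := e1 hwy b; omega
    · omega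
    · have := b.lt; have := e1 h4 b; omega
    · omega
  · rintro (⟨a, b⟩ | ⟨a, b⟩)
    · exact Or.inl ⟨b, Or.inl ⟨a ▸ h4, by omega⟩⟩
    · exact Or.inr (Or.inl ⟨b, Or.inl ⟨a ▸ h2, by omega⟩⟩)

theorem PInv.val (H : PInv L R B p q) (i j : Fin n) :
    (PPos L R p q i j ∧ ¬ PPos L R p q j i ∧ B i j = 1 ∧ B j i = -1) ∨
    (PPos L R p q j i ∧ ¬ PPos L R p q i j ∧ B i j = -1 ∧ B j i = 1) ∨
    (¬ PPos L R p q j i ∧ ¬ PPos L R p q i j ∧ B i j = 0 ∧ B j i = 0) := by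
  have a1 := H.pos i j; have a2 := H.pos j i; have a3 := H.neg i j; have a4 := H.neg j i
  have a5 := H.zer i j; have a6 := H.zer j i
  by_cases u : PPos L R p q i j <;> by_cases v : PPos L R p q j i
  · have := a1 u; have := a3 v; omega
  · exact Or.inl ⟨u, v, a1 u, a4 u⟩
  · exact Or.inr (Or.inl ⟨v, u, a3 v, a2 v⟩)
  · exact Or.inr (Or.inr ⟨v, u, a5 u v, a6 v u⟩)

theorem mutB {b c e : ℤ} (hb : b = 1 ∨ b = -1 ∨ b = 0) (hc : c = 1 ∨ c = -1 ∨ c = 0) :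
    e + b.sign * max (b * c) 0 = e + (if b = 1 ∧ c = 1 then 1 else 0) -
      (if b = -1 ∧ c = -1 then 1 else 0) := by
  rcases hb with rfl | rfl | rfl <;> rcases hc with rfl | rfl | rfl <;> simp; rfl

set_option maxHeartbeats 4000000 in
theorem mut_aux {w x y z pi qi pj qj bik bki bkj bjk bij bji : ℤ} {U V : Prop}
    (l1 : w < x) (l2 : x < y) (l3 : y < z)
    (vi : (pi = x ∧ qi = y ∨ pi = w ∧ qi = z) ∧ ¬(pi = w ∧ qi = x ∨ pi = y ∧ qi = z) ∧
        bik = 1 ∧ bki = -1 ∨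
      (pi = w ∧ qi = x ∨ pi = y ∧ qi = z) ∧ ¬(pi = x ∧ qi = y ∨ pi = w ∧ qi = z) ∧
        bik = -1 ∧ bki = 1 ∨
      ¬(pi = w ∧ qi = x ∨ pi = y ∧ qi = z) ∧ ¬(pi = x ∧ qi = y ∨ pi = w ∧ qi = z) ∧
        bik = 0 ∧ bki = 0)
    (vj : (pj = w ∧ qj = x ∨ pj = y ∧ qj = z) ∧ ¬(pj = x ∧ qj = y ∨ pj = w ∧ qj = z) ∧
        bkj = 1 ∧ bjk = -1 ∨
      (pj = x ∧ qj = y ∨ pj = w ∧ qj = z) ∧ ¬(pj = w ∧ qj = x ∨ pj = y ∧ qj = z) ∧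
        bkj = -1 ∧ bjk = 1 ∨
      ¬(pj = x ∧ qj = y ∨ pj = w ∧ qj = z) ∧ ¬(pj = w ∧ qj = x ∨ pj = y ∧ qj = z) ∧
        bkj = 0 ∧ bjk = 0)
    (vij : U ∧ ¬V ∧ bij = 1 ∧ bji = -1 ∨ V ∧ ¬U ∧ bij = -1 ∧ bji = 1 ∨
      ¬V ∧ ¬U ∧ bij = 0 ∧ bji = 0)
    (z1 : pi = w → qi = x → pj = x → qj = y → U)
    (z2 : pi = y → qi = z → pj = w → qj = z → U)
    (z1' : pj = w → qj = x → pi = x → qi = y → V)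
    (z2' : pj = y → qj = z → pi = w → qi = z → V)
    (z3 : pi = x → qi = y → pj = y → qj = z → ¬U ∧ ¬V)
    (z4 : pi = w → qi = z → pj = w → qj = x → ¬U ∧ ¬V)
    (z3' : pj = x → qj = y → pi = y → qi = z → ¬V ∧ ¬U)
    (z4' : pj = w → qj = z → pi = w → qi = x → ¬V ∧ ¬U) :
    ((U ∧ ¬((pi = w ∧ qi = x ∧ pj = x ∧ qj = y) ∨ (pi = y ∧ qi = z ∧ pj = w ∧ qj = z))) ∨
      (pi = x ∧ qi = y ∧ pj = y ∧ qj = z) ∨ (pi = w ∧ qi = z ∧ pj = w ∧ qj = x) →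
      bij + (if bik = 1 ∧ bkj = 1 then 1 else 0) - (if bik = -1 ∧ bkj = -1 then 1 else 0) = 1) ∧
    ((V ∧ ¬((pj = w ∧ qj = x ∧ pi = x ∧ qi = y) ∨ (pj = y ∧ qj = z ∧ pi = w ∧ qi = z))) ∨
      (pj = x ∧ qj = y ∧ pi = y ∧ qi = z) ∨ (pj = w ∧ qj = z ∧ pi = w ∧ qi = x) →
      bij + (if bik = 1 ∧ bkj = 1 then 1 else 0) - (if bik = -1 ∧ bkj = -1 then 1 else 0) = -1) ∧
    (¬ ((U ∧ ¬((pi = w ∧ qi = x ∧ pj = x ∧ qj = y) ∨ (pi = y ∧ qi = z ∧ pj = w ∧ qj = z))) ∨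
      (pi = x ∧ qi = y ∧ pj = y ∧ qj = z) ∨ (pi = w ∧ qi = z ∧ pj = w ∧ qj = x)) →
     ¬ ((V ∧ ¬((pj = w ∧ qj = x ∧ pi = x ∧ qi = y) ∨ (pj = y ∧ qj = z ∧ pi = w ∧ qi = z))) ∨
      (pj = x ∧ qj = y ∧ pi = y ∧ qi = z) ∨ (pj = w ∧ qj = z ∧ pi = w ∧ qi = x)) →
      bij + (if bik = 1 ∧ bkj = 1 then 1 else 0) - (if bik = -1 ∧ bkj = -1 then 1 else 0) = 0) := by
  have n1 : x ≠ w := by omega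
  have n2 : y ≠ w := by omega
  have n3 : z ≠ w := by omega
  have n4 : y ≠ x := by omega
  have n5 : z ≠ x := by omega
  have n6 : z ≠ y := by omega
  rcases vi with ⟨⟨rfl, rfl⟩ | ⟨rfl, rfl⟩, -, rfl, -⟩ | ⟨⟨rfl, rfl⟩ | ⟨rfl, rfl⟩, -, rfl, -⟩ |
    ⟨r1, r2, rfl, -⟩ <;>
  rcases vj with ⟨⟨rfl, rfl⟩ | ⟨rfl, rfl⟩, -, rfl, -⟩ | ⟨⟨rfl, rfl⟩ | ⟨rfl, rfl⟩, -, rfl, -⟩ |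
    ⟨s1, s2, rfl, -⟩ <;>
  rcases vij with ⟨t1, t2, rfl, -⟩ | ⟨t1, t2, rfl, -⟩ | ⟨t1, t2, rfl, -⟩ <;>
  simp_all [n1.symm, n2.symm, n4.symm, n5.symm, n6.symm]

theorem PInv.flip1 (H : PInv L R B p q) (k : Fin n) {w x y z : ℤ}
    (hk : p k = w) (hk' : q k = y) (h1 : PE L R p q w x) (h2 : PE L R p q x y)
    (h3 : PE L R p q y z) (h4 : PE L R p q w z) :
    PInv L R (mutMat k B) (Function.update p k x) (Function.update q k z) := by
  have hwy : PE L R p q w y := by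
    have := H.pe k
    rwa [hk, hk'] at this
  have l1 := h1.lt; have l2 := h2.lt; have l3 := h3.lt; have l4 := h4.lt
  have b1 := h1.1; have b2 := h4.2.2.1
  have e1 := @PInv.enc n L R B p q H
  have hxz : ¬ PE L R p q x z := fun h => e1 hwy h (by omega)
  have PE' := H.pe' k hk hk' h1 h2 h3 h4
  have key : ∀ j, j ≠ k → ¬ (p j < x ∧ x < q j ∧ q j < z) ∧ ¬ (x < p j ∧ p j < z ∧ z < q j) := by
    intro j hj
    have ej := H.pe j
    have := e1 h1 ej; have := e1 ej h1
    have := e1 h2 ej; have := e1 ej h2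
    have := e1 h3 ej; have := e1 ej h3
    have := e1 h4 ej; have := e1 ej h4
    have : ¬ (p j = w ∧ q j = y) := fun h => hj (H.inj j k (by omega) (by omega))
    omega
  have main : ∀ i j, (PPos L R (Function.update p k x) (Function.update q k z) i j →
      mutMat k B i j = 1) ∧ (PPos L R (Function.update p k x) (Function.update q k z) j i →
      mutMat k B i j = -1) ∧ (¬ PPos L R (Function.update p k x) (Function.update q k z) i j → 
      ¬ PPos L R (Function.update p k x) (Function.update q k z) j i → mutMat k B i j = 0) := by
    intro i j
    by_cases hi : i = k
    · subst hi
      have := H.pos'k i hk hk' h1 h2 h3 h4 j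
      rw [this.1, this.2]
      have := H.val i j
      simp only [mutMat, true_or, if_true]
      grind
    by_cases hj : j = k
    · subst hj
      have := H.pos'k j hk hk' h1 h2 h3 h4 i
      rw [this.1, this.2]
      have := H.val i j
      simp only [mutMat, or_true, if_true]
      grind
    rw [H.pos' k hk hk' h1 h2 h3 h4 i j hi hj, H.pos' k hk hk' h1 h2 h3 h4 j i hj hi]
    have ci := H.col k hk hk' h1 h2 h3 h4 i
    have cj := H.col k hk hk' h1 h2 h3 h4 j
    have vi := H.val i k
    have vj := H.val k j
    have vij := H.val i j
    rw [ci.1, ci.2] at vi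
    rw [cj.1, cj.2] at vj
    have m : mutMat k B i j = B i j + (if B i k = 1 ∧ B k j = 1 then 1 else 0) -
      (if B i k = -1 ∧ B k j = -1 then 1 else 0) := by
      simp only [mutMat, hi, hj, or_self, if_false]
      apply mutB <;> omega
    rw [m]
    have z1 : p i = w → q i = x → p j = x → q j = y → PPos L R p q i j := by
      intro a b c d
      exact Or.inl ⟨by omega, by rwa [a, d]⟩
    have z2 : p i = y → q i = z → p j = w → q j = z → PPos L R p q i j := by
      intro a b c d
      exact Or.inr (Or.inl ⟨by omega, by rwa [a, c]⟩)
    have z1' : p j = w → q j = x → p i = x → q i = y → PPos L R p q j i := by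
      intro a b c d
      exact Or.inl ⟨by omega, by rwa [a, d]⟩
    have z2' : p j = y → q j = z → p i = w → q i = z → PPos L R p q j i := by
      intro a b c d
      exact Or.inr (Or.inl ⟨by omega, by rwa [a, c]⟩)
    have z3 : p i = x → q i = y → p j = y → q j = z → ¬ PPos L R p q i j ∧ ¬ PPos L R p q j i := by
      intro a b c d
      unfold PPos
      rw [a, b, c, d]
      refine ⟨fun h => ?_, fun h => ?_⟩
      · rcases h with h | h | h
        · exact hxz h.2
        · omega
        · omega
      · omega
    have z4 : p i = w → q i = z → p j = w → q j = x → ¬ PPos L R p q i j ∧ ¬ PPos L R p q j i := by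
      intro a b c d
      unfold PPos
      rw [a, b, c, d]
      refine ⟨fun h => ?_, fun h => ?_⟩
      · rcases h with h | h | h
        · omega
        · omega
        · exact hxz h.2
      · rcases h with h | h | h
        · omega
        · omega
        · have := h.2.lt
          omega
    have z3' : p j = x → q j = y → p i = y → q i = z → ¬ PPos L R p q j i ∧ ¬ PPos L R p q i j := by
      intro a b c d
      unfold PPos
      rw [a, b, c, d]
      refine ⟨fun h => ?_, fun h => ?_⟩
      · rcases h with h | h | h
        · exact hxz h.2
        · omega
        · omega
      · omega
    have z4' : p j = w → q j = z → p i = w → q i = x → ¬ PPos L R p q j i ∧ ¬ PPos L R p q i j := by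
      intro a b c d
      unfold PPos
      rw [a, b, c, d]
      refine ⟨fun h => ?_, fun h => ?_⟩
      · rcases h with h | h | h
        · omega
        · omega
        · exact hxz h.2
      · rcases h with h | h | h
        · omega
        · omega
        · have := h.2.lt
          omega
    exact mut_aux l1 l2 l3 vi vj vij z1 z2 z1' z2' z3 z4 z3' z4'
  refine ⟨?_, ?_, ?_, ?_, ?_, fun i j => (main i j).1, fun i j => (main i j).2.1,
    fun i j => (main i j).2.2⟩
  · intro j
    by_cases hj : j = k
    · subst hj
      simp
      omega
    · simp only [Function.update_of_ne hj]
      exact H.dg j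
  · intro i j
    by_cases hi : i = k <;> by_cases hj : j = k
    · intro _ _
      rw [hi, hj]
    · subst hi
      simp only [Function.update_self, Function.update_of_ne hj]
      intro a b
      exact absurd (a ▸ b ▸ H.pe j) hxz
    · subst hj
      simp only [Function.update_self, Function.update_of_ne hi]
      intro a b
      exact absurd (a ▸ b ▸ H.pe i) hxz
    · simp only [Function.update_of_ne hi, Function.update_of_ne hj]
      exact H.inj i j
  · intro i j
    by_cases hi : i = k <;> by_cases hj : j = k
    · subst hi hj
      simp
    · subst hi
      simp only [Function.update_self, Function.update_of_ne hj]
      have := key j hj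
      omega
    · subst hj
      simp only [Function.update_self, Function.update_of_ne hi]
      have := key i hi
      omega
    · simp only [Function.update_of_ne hi, Function.update_of_ne hj]
      exact H.nc i j
  · intro j
    by_cases hj : j = k
    · subst hj
      simp only [Function.update_self, PE']
      exact ⟨y, Or.inl ⟨h2, by omega⟩, Or.inl ⟨h3, by omega⟩⟩
    · simp only [Function.update_of_ne hj, PE']
      obtain ⟨t, t1, t2⟩ := H.inn j
      have ej := H.pe j
      by_cases g : p j = w ∧ t = y
      · refine ⟨x, Or.inl ⟨g.1 ▸ h1, by omega⟩, Or.inr ⟨rfl, ?_⟩⟩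
        have := t2.lt
        obtain ⟨g1, rfl⟩ := g
        have := e1 h4 t2
        have := e1 ej h3
        omega
      by_cases g' : t = w ∧ q j = y
      · have := t1.lt
        have := e1 ej h4
        omega
      exact ⟨t, Or.inl ⟨t1, g⟩, Or.inl ⟨t2, g'⟩⟩
  · intro j
    by_cases hj : j = k
    · subst hj
      simp only [Function.update_self, PE']
      exact ⟨w, Or.inr ⟨Or.inl ⟨h1, by omega⟩, Or.inl ⟨h4, by omega⟩⟩⟩
    · simp only [Function.update_of_ne hj, PE']
      obtain ⟨t, ⟨t1, t2⟩ | ⟨t1, t2⟩⟩ := H.out j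
      · by_cases g : q j = w ∧ t = y
        · have := e1 t2 h4
          have := (H.pe j).lt
          omega
        by_cases g' : p j = w ∧ t = y
        · obtain ⟨g1, rfl⟩ := g'
          have := (H.pe j).lt
          have := t1.lt
          have := e1 h1 t1
          have := e1 (H.pe j) h2
          have : q j = x := by omega
          exact ⟨z, Or.inl ⟨Or.inr ⟨this, rfl⟩, Or.inl ⟨g1 ▸ h4, by omega⟩⟩⟩
        exact ⟨t, Or.inl ⟨Or.inl ⟨t1, g⟩, Or.inl ⟨t2, g'⟩⟩⟩
      · by_cases g : t = w ∧ p j = y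
        · obtain ⟨rfl, g1⟩ := g
          have := (H.pe j).lt
          have := e1 h4 (H.pe j)
          have := e1 t2 h3
          have : q j = z := by omega
          exact ⟨x, Or.inr ⟨Or.inl ⟨g1 ▸ h2, by omega⟩, Or.inr ⟨rfl, this⟩⟩⟩
        by_cases g' : t = w ∧ q j = y
        · obtain ⟨rfl, g1⟩ := g'
          have := (H.pe j).lt
          have := t1.lt
          have := e1 h1 (H.pe j)
          have := e1 t1 h2
          have : p j = x := by omega
          exact ⟨z, Or.inl ⟨Or.inl ⟨g1 ▸ h3, by omega⟩, Or.inr ⟨this, rfl⟩⟩⟩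
        exact ⟨t, Or.inr ⟨Or.inl ⟨t1, g⟩, Or.inl ⟨t2, g'⟩⟩⟩

end flip

/-! ### Weighted families of noncrossing chords -/

/-- crossing number of the chord `(a,b)` with `(p,q)` -/
def cr (p q a b : ℤ) : ℤ :=
  if a = p ∧ b = q then -1
  else if (p < a ∧ a < q ∧ (b < p ∨ q < b)) ∨ (p < b ∧ b < q ∧ (a < p ∨ q < a)) then 1 else 0

structure PFam {m : ℕ} (L R : ℤ) (P Q : Fin m → ℤ) : Prop where
  dg : ∀ j, L ≤ P j ∧ P j + 2 ≤ Q j ∧ Q j ≤ R ∧ (P j = L → Q j ≠ R)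
  inj : ∀ i j, P i = P j → Q i = Q j → i = j
  nc : ∀ i j, P i < P j → P j < Q i → Q i < Q j → False

open Classical in
/-- rational indicator -/
def ii (A : ℤ → Prop) (t : ℤ) : ℚ := if A t then 1 else 0

def SS {m : ℕ} (P Q : Fin m → ℤ) (x : Fin m → ℚ) (A B : ℤ → Prop) : ℚ :=
  ∑ i, x i * (ii A (P i) * ii B (Q i) + ii A (Q i) * ii B (P i))

def MM {m : ℕ} (P Q : Fin m → ℤ) (x : Fin m → ℚ) (a b : ℤ) : ℚ :=
  ∑ i, x i * (cr (P i) (Q i) a b : ℚ)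

section kernel
variable {m : ℕ} {L R : ℤ} {P Q : Fin m → ℤ} {x : Fin m → ℚ}

theorem SS_comm (A B : ℤ → Prop) : SS P Q x A B = SS P Q x B A := by
  unfold SS
  exact Finset.sum_congr rfl fun i _ => by ring

theorem SS_split (A A1 A2 A3 B : ℤ → Prop)
    (h : ∀ t, ii A t = ii A1 t + ii A2 t + ii A3 t) :
    SS P Q x A B = SS P Q x A1 B + SS P Q x A2 B + SS P Q x A3 B := by
  unfold SS
  rw [← Finset.sum_add_distrib, ← Finset.sum_add_distrib]
  refine Finset.sum_congr rfl fun i _ => ?_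
  rw [h, h]
  ring

def Crs (a b c d : ℤ) : Prop :=
  (((a < c ∧ c < b) ∨ (b < c ∧ c < a)) ∧ ((d < a ∧ d < b) ∨ (a < d ∧ b < d))) ∨
  (((a < d ∧ d < b) ∨ (b < d ∧ d < a)) ∧ ((c < a ∧ c < b) ∨ (a < c ∧ b < c)))

theorem ii_mul_eq_zero {A B : ℤ → Prop} {s t : ℤ} (h : ¬ (A s ∧ B t)) : ii A s * ii B t = 0 := by
  unfold ii
  by_cases h1 : A s
  · have : ¬ B t := fun h2 => h ⟨h1, h2⟩
    simp [this]
  · simp [h1]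

theorem SS_dis (H : PFam L R P Q) (A B C D : ℤ → Prop)
    (h : ∀ a b c d, A a → B b → C c → D d → Crs a b c d) :
    SS P Q x A B = 0 ∨ SS P Q x C D = 0 := by
  by_cases hi : ∃ i, (A (P i) ∧ B (Q i)) ∨ (A (Q i) ∧ B (P i))
  · right
    obtain ⟨i, hi⟩ := hi
    unfold SS
    refine Finset.sum_eq_zero fun j _ => ?_
    have nc1 : ¬ (P i < P j ∧ P j < Q i ∧ Q i < Q j) := fun h => H.nc i j h.1 h.2.1 h.2.2
    have nc2 : ¬ (P j < P i ∧ P i < Q j ∧ Q j < Q i) := fun h => H.nc j i h.1 h.2.1 h.2.2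
    have d1 := (H.dg i).2.1
    have d2 := (H.dg j).2.1
    rw [ii_mul_eq_zero, ii_mul_eq_zero]
    · simp
    · rintro ⟨u, v⟩
      rcases hi with ⟨a, b⟩ | ⟨a, b⟩
      · have := h _ _ _ _ a b u v
        unfold Crs at this
        omega
      · have := h _ _ _ _ a b u v
        unfold Crs at this
        omega
    · rintro ⟨u, v⟩
      rcases hi with ⟨a, b⟩ | ⟨a, b⟩
      · have := h _ _ _ _ a b u v
        unfold Crs at this
        omega
      · have := h _ _ _ _ a b u v
        unfold Crs at this
        omega
  · left
    push Not at hi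
    unfold SS
    refine Finset.sum_eq_zero fun j _ => ?_
    rw [ii_mul_eq_zero, ii_mul_eq_zero]
    · simp
    · rintro ⟨u, v⟩
      exact (hi j).2 u v
    · rintro ⟨u, v⟩
      exact (hi j).1 u v

/-- The open interval between two vertices. -/
def Io (a b : ℤ) (t : ℤ) : Prop := a < t ∧ t < b
/-- A single vertex. -/
def At (a : ℤ) (t : ℤ) : Prop := t = a
/-- The outside of a chord. -/
def Ou (a b : ℤ) (t : ℤ) : Prop := t < a ∨ b < t

theorem MM_eq (H : PFam L R P Q) {a b : ℤ} (hab : a < b) :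
    MM P Q x a b = SS P Q x (Io a b) (Ou a b) - SS P Q x (At a) (At b) := by
  unfold MM SS
  rw [← Finset.sum_sub_distrib]
  refine Finset.sum_congr rfl fun i _ => ?_
  have := (H.dg i).2.1
  rw [← mul_sub]
  congr 1
  unfold cr ii
  by_cases h1 : a = P i ∧ b = Q i
  · have e1 : At a (P i) := h1.1.symm
    have e2 : At b (Q i) := h1.2.symm
    have e3 : ¬ Io a b (P i) := by unfold Io; omega
    have e4 : ¬ Io a b (Q i) := by unfold Io; omega
    have e5 : ¬ At b (P i) := by unfold At; omega
    simp [h1, e1, e2, e3, e4, e5]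
    rw [h1.1, h1.2] at *
    simp [e1, e2, e3, e4, e5]
  · rw [if_neg h1]
    have e1 : ¬ (At a (P i) ∧ At b (Q i)) := by unfold At; omega
    have e2 : ¬ (At a (Q i) ∧ At b (P i)) := by unfold At; omega
    have z1 := ii_mul_eq_zero e1
    have z2 := ii_mul_eq_zero e2
    unfold ii at z1 z2
    rw [z1, z2]
    by_cases g1 : Io a b (P i) ∧ Ou a b (Q i)
    · have e3 : ¬ Io a b (Q i) := by unfold Io; have := g1.2; unfold Ou at this; omega
      rw [if_pos]
      · simp [g1, e3]
      · simp only [Io, Ou] at *; omega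
    by_cases g2 : Io a b (Q i) ∧ Ou a b (P i)
    · have e3 : ¬ Io a b (P i) := by unfold Io; have := g2.2; unfold Ou at this; omega
      rw [if_pos]
      · simp [g2, e3]
      · simp only [Io, Ou] at *; omega
    have z3 := ii_mul_eq_zero g1
    have z4 := ii_mul_eq_zero g2
    unfold ii at z3 z4
    rw [z3, z4, if_neg]
    · simp
    · simp only [Io, Ou] at *; omega

theorem ii_split {A A1 A2 A3 : ℤ → Prop} (h : ∀ t, A t ↔ A1 t ∨ A2 t ∨ A3 t)
    (h12 : ∀ t, ¬ (A1 t ∧ A2 t)) (h13 : ∀ t, ¬ (A1 t ∧ A3 t)) (h23 : ∀ t, ¬ (A2 t ∧ A3 t)) (t : ℤ) :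
    ii A t = ii A1 t + ii A2 t + ii A3 t := by
  have h := h t
  have h12 := h12 t
  have h13 := h13 t
  have h23 := h23 t
  unfold ii
  by_cases a1 : A1 t <;> by_cases a2 : A2 t <;> by_cases a3 : A3 t <;> simp_all

theorem ii_Ou {a b c : ℤ} (hab : a < b) (hbc : b < c) (t : ℤ) :
    ii (Ou a b) t = ii (Io b c) t + ii (At c) t + ii (Ou a c) t := by
  apply ii_split <;> (intro t; simp only [Ou, Io, At]; omega)

theorem ii_Ou' {a b c : ℤ} (hab : a < b) (hbc : b < c) (t : ℤ) :
    ii (Ou b c) t = ii (Io a b) t + ii (At a) t + ii (Ou a c) t := by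
  apply ii_split <;> (intro t; simp only [Ou, Io, At]; omega)

theorem ii_Io {a b c : ℤ} (hab : a < b) (hbc : b < c) (t : ℤ) :
    ii (Io a c) t = ii (Io a b) t + ii (At b) t + ii (Io b c) t := by
  apply ii_split <;> (intro t; simp only [Io, At]; omega)

theorem SS_split' (A A1 A2 A3 B : ℤ → Prop)
    (h : ∀ t, ii A t = ii A1 t + ii A2 t + ii A3 t) :
    SS P Q x B A = SS P Q x B A1 + SS P Q x B A2 + SS P Q x B A3 := by
  rw [SS_comm, SS_split A A1 A2 A3 B h, SS_comm A1, SS_comm A2, SS_comm A3]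

theorem tri_lin {ka kb kc za zb zc eab ebc eac : ℚ}
    (h1 : ka + kb + zc - eab = 0) (h2 : kb + kc + za - ebc = 0) (h3 : ka + kc + zb - eac = 0)
    (a1 : ka = 0 ∨ za = 0) (a2 : kb = 0 ∨ zb = 0) (a3 : kc = 0 ∨ zc = 0)
    (b1 : za = 0 ∨ zb = 0) (b2 : za = 0 ∨ zc = 0) (b3 : zb = 0 ∨ zc = 0)
    (c1 : eab = 0 ∨ (ka = 0 ∧ kb = 0 ∧ zc = 0)) (c2 : ebc = 0 ∨ (kb = 0 ∧ kc = 0 ∧ za = 0))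
    (c3 : eac = 0 ∨ (ka = 0 ∧ kc = 0 ∧ zb = 0)) :
    ka = 0 ∧ kb = 0 ∧ kc = 0 ∧ za = 0 ∧ zb = 0 ∧ zc = 0 ∧ eab = 0 ∧ ebc = 0 ∧ eac = 0 := by
  have d1 : eab = 0 := by rcases c1 with c | ⟨c, c', c''⟩ <;> linarith
  have d2 : ebc = 0 := by rcases c2 with c | ⟨c, c', c''⟩ <;> linarith
  have d3 : eac = 0 := by rcases c3 with c | ⟨c, c', c''⟩ <;> linarith
  subst d1 d2 d3
  rcases eq_or_ne za 0 with z | z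
  · rcases eq_or_ne zb 0 with z' | z'
    · rcases eq_or_ne zc 0 with z'' | z''
      · refine ⟨?_, ?_, ?_, z, z', z'', rfl, rfl, rfl⟩ <;> linarith
      · have := a3.resolve_right z''
        refine ⟨?_, ?_, ?_, z, z', ?_, rfl, rfl, rfl⟩ <;> linarith
    · have := a2.resolve_right z'
      have := b3.resolve_left z'
      refine ⟨?_, ?_, ?_, z, ?_, ?_, rfl, rfl, rfl⟩ <;> linarith
  · have := a1.resolve_right z
    have := b1.resolve_left z
    have := b2.resolve_left z
    refine ⟨?_, ?_, ?_, ?_, ?_, ?_, rfl, rfl, rfl⟩ <;> linarith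

theorem tri_zero (H : PFam L R P Q) {a b c : ℤ} (hab : a < b) (hbc : b < c)
    (h1 : MM P Q x a b = 0) (h2 : MM P Q x b c = 0) (h3 : MM P Q x a c = 0) :
    SS P Q x (Io a b) (Ou a c) = 0 ∧ SS P Q x (Io a b) (Io b c) = 0 ∧
    SS P Q x (Io b c) (Ou a c) = 0 ∧ SS P Q x (Io b c) (At a) = 0 ∧
    SS P Q x (At b) (Ou a c) = 0 ∧ SS P Q x (Io a b) (At c) = 0 ∧
    SS P Q x (At a) (At b) = 0 ∧ SS P Q x (At b) (At c) = 0 ∧ SS P Q x (At a) (At c) = 0 := by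
  rw [MM_eq H (by omega)] at h1 h2 h3
  rw [SS_split' _ _ _ _ _ (ii_Ou hab hbc)] at h1
  rw [SS_split' _ _ _ _ _ (ii_Ou' hab hbc), SS_comm (Io b c) (Io a b)] at h2
  rw [SS_split _ _ _ _ _ (ii_Io hab hbc)] at h3
  have dis := @SS_dis m L R P Q x H
  apply tri_lin
  · linarith
  · linarith
  · linarith
  · apply dis; simp only [Io, Ou, At, Crs]; intros; omega
  · apply dis; simp only [Io, Ou, At, Crs]; intros; omega
  · apply dis; simp only [Io, Ou, At, Crs]; intros; omega
  · apply dis; simp only [Io, Ou, At, Crs]; intros; omega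
  · apply dis; simp only [Io, Ou, At, Crs]; intros; omega
  · apply dis; simp only [Io, Ou, At, Crs]; intros; omega
  · rw [or_and_left, or_and_left]
    refine ⟨?_, ?_, ?_⟩ <;> (apply dis; simp only [Io, Ou, At, Crs]; intros; omega)
  · rw [or_and_left, or_and_left]
    refine ⟨?_, ?_, ?_⟩ <;> (apply dis; simp only [Io, Ou, At, Crs]; intros; omega)
  · rw [or_and_left, or_and_left]
    refine ⟨?_, ?_, ?_⟩ <;> (apply dis; simp only [Io, Ou, At, Crs]; intros; omega)

theorem grid_lin {a1 a2 a3 b1 b2 b3 c1 c2 c3 : ℚ}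
    (r1 : a1 + a2 + a3 = 0) (r2 : b1 + b2 + b3 = 0) (r3 : c1 + c2 + c3 = 0)
    (s1 : a1 + b1 + c1 = 0) (s2 : a2 + b2 + c2 = 0) (s3 : a3 + b3 + c3 = 0)
    (h1 : a3 = 0 ∨ (b1 = 0 ∧ b2 = 0 ∧ c1 = 0 ∧ c2 = 0))
    (h2 : c1 = 0 ∨ (a2 = 0 ∧ a3 = 0 ∧ b2 = 0 ∧ b3 = 0))
    (h3 : a2 = 0 ∨ b1 = 0) (h4 : b3 = 0 ∨ c2 = 0) : a3 = 0 ∧ b2 = 0 ∧ c1 = 0 := by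
  have e1 : a3 = 0 := by
    rcases h1 with h | ⟨h, h', h'', h'''⟩ <;> linarith
  have e2 : c1 = 0 := by
    rcases h2 with h | ⟨h, h', h'', h'''⟩ <;> linarith
  refine ⟨e1, ?_, e2⟩
  rcases h3 with h | h <;> rcases h4 with h' | h' <;> linarith

theorem ker_flip (H : PFam L R P Q) {w x' y z : ℤ} (hwx : w < x') (hxy : x' < y) (hyz : y < z)
    (h1 : MM P Q x w x' = 0) (h2 : MM P Q x x' y = 0) (h3 : MM P Q x y z = 0)
    (h4 : MM P Q x w z = 0) (h5 : MM P Q x x' z = 0) : MM P Q x w y = 0 := by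
  have t1 := tri_zero H hxy hyz h2 h3 h5
  have t2 := tri_zero H hwx (hxy.trans hyz) h1 h5 h4
  have dis := @SS_dis m L R P Q x H
  obtain ⟨k1, k2, k3, k4, k5, k6, -, -, k9⟩ := t1
  obtain ⟨l1, l2, l3, l4, l5, l6, -, -, l9⟩ := t2
  have sp := ii_Ou' hwx (hxy.trans hyz)
  have sp2 := ii_Io hxy hyz
  rw [SS_split' _ _ _ _ _ sp] at k1 k3 k5
  rw [SS_split' _ _ _ _ _ sp2] at l2
  rw [SS_split _ _ _ _ _ sp2] at l3 l4
  rw [SS_comm (Io w x')] at l2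
  rw [SS_comm (Io w x') (At y), SS_comm (Io w x') (Io y z)] at l2
  have g := grid_lin k1 k5 k3 l2 l4 l3 ?_ ?_ ?_ ?_
  · rw [MM_eq H (by omega), SS_split _ _ _ _ _ (ii_Io hwx hxy),
      SS_split' _ _ _ _ _ (ii_Ou (hwx.trans hxy) hyz),
      SS_split' _ _ _ _ _ (ii_Ou (hwx.trans hxy) hyz),
      SS_split' _ _ _ _ _ (ii_Ou (hwx.trans hxy) hyz)]
    obtain ⟨g1, g2, g3⟩ := g
    rw [SS_comm (Io w x') (Io y z), SS_comm (At x') (Io y z), SS_comm (At w) (At y)]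
    linarith
  · rw [or_and_left, or_and_left, or_and_left]
    refine ⟨?_, ?_, ?_, ?_⟩ <;> (apply dis; simp only [Io, Ou, At, Crs]; intros; omega)
  · rw [or_and_left, or_and_left, or_and_left]
    refine ⟨?_, ?_, ?_, ?_⟩ <;> (apply dis; simp only [Io, Ou, At, Crs]; intros; omega)
  · apply dis; simp only [Io, Ou, At, Crs]; intros; omega
  · apply dis; simp only [Io, Ou, At, Crs]; intros; omega

end kernel

/-! ### Flips -/

set_option maxHeartbeats 2000000 in
theorem trop_ptolemy {p q w x y z : ℤ} (hpq : p < q) (h1 : w < x) (h2 : x < y) (h3 : y < z) :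
    cr p q x z + cr p q w y = max (cr p q x y + cr p q w z) (cr p q w x + cr p q y z) := by
  have e : p < w ∨ p = w ∨ (w < p ∧ p < x) ∨ p = x ∨ (x < p ∧ p < y) ∨ p = y ∨
    (y < p ∧ p < z) ∨ p = z ∨ z < p := by omega
  have f : q < w ∨ q = w ∨ (w < q ∧ q < x) ∨ q = x ∨ (x < q ∧ q < y) ∨ q = y ∨
    (y < q ∧ q < z) ∨ q = z ∨ z < q := by omega
  rcases e with e | e | e | e | e | e | e | e | e <;>
  rcases f with f | f | f | f | f | f | f | f | f <;>
  first
  | (exfalso; omega)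
  | (simp (disch := omega) only [cr, if_pos, if_neg]; done)
  | (simp (disch := omega) only [cr, if_pos, if_neg]; rfl)

theorem cr_bdry {L R p q a b : ℤ} (h : L ≤ p ∧ p + 2 ≤ q ∧ q ≤ R ∧ (p = L → q ≠ R))
    (h' : b = a + 1 ∨ (a = L ∧ b = R)) : cr p q a b = 0 := by
  unfold cr
  rw [if_neg (by omega), if_neg (by omega)]

theorem cr_neg {p q a b : ℤ} : cr (-q) (-p) (-b) (-a) = cr p q a b := by
  unfold cr
  split_ifs <;> omega

theorem MM_neg {m : ℕ} {P Q : Fin m → ℤ} {x : Fin m → ℚ} (a b : ℤ) :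
    MM (fun j => -Q j) (fun j => -P j) x (-b) (-a) = MM P Q x a b := by
  unfold MM
  exact Finset.sum_congr rfl fun i _ => by rw [cr_neg]

theorem PFam.neg {m : ℕ} {L R : ℤ} {P Q : Fin m → ℤ} (H : PFam L R P Q) :
    PFam (-R) (-L) (fun j => -Q j) (fun j => -P j) where
  dg j := by have := H.dg j; omega
  inj i j h1 h2 := H.inj i j (by simpa using h2) (by simpa using h1)
  nc i j h1 h2 h3 := H.nc j i (by simpa using h3) (by simpa using h2) (by simpa using h1)

theorem MM_bdry {m : ℕ} {L R : ℤ} {P Q : Fin m → ℤ} (H : PFam L R P Q) (x : Fin m → ℚ) {a b : ℤ}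
    (h' : b = a + 1 ∨ (a = L ∧ b = R)) : MM P Q x a b = 0 := by
  unfold MM
  exact Finset.sum_eq_zero fun i _ => by rw [cr_bdry (H.dg i) h']; simp

theorem PE.neg {n : ℕ} {L R : ℤ} {p q : Fin n → ℤ} {a b : ℤ} (h : PE L R p q a b) :
    PE (-R) (-L) (fun j => -q j) (fun j => -p j) (-b) (-a) := by
  obtain ⟨h1, h2, h3, h4⟩ := h
  refine ⟨by omega, by omega, by omega, ?_⟩
  rcases h4 with h | h | ⟨j, h, h'⟩
  · left; omega
  · right; left; omega
  · right; right; exact ⟨j, by simp [h'], by simp [h]⟩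

theorem PE.neg_iff {n : ℕ} {L R : ℤ} {p q : Fin n → ℤ} {a b : ℤ} :
    PE (-R) (-L) (fun j => -q j) (fun j => -p j) (-b) (-a) ↔ PE L R p q a b := by
  refine ⟨fun h => ?_, PE.neg⟩
  have := h.neg
  simpa using this

theorem PPos.neg_iff {n : ℕ} {L R : ℤ} {p q : Fin n → ℤ} {i j : Fin n} :
    PPos (-R) (-L) (fun j => -q j) (fun j => -p j) i j ↔ PPos L R p q j i := by
  unfold PPos
  simp only [PE.neg_iff, neg_inj]
  constructor
  · rintro (⟨h, h'⟩ | ⟨h, h'⟩ | ⟨h, h'⟩)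
    · exact Or.inl ⟨h.symm, h'⟩
    · exact Or.inr (Or.inr ⟨h.symm, h'⟩)
    · exact Or.inr (Or.inl ⟨h.symm, h'⟩)
  · rintro (⟨h, h'⟩ | ⟨h, h'⟩ | ⟨h, h'⟩)
    · exact Or.inl ⟨h.symm, h'⟩
    · exact Or.inr (Or.inr ⟨h.symm, h'⟩)
    · exact Or.inr (Or.inl ⟨h.symm, h'⟩)

theorem mutMat_neg {n : ℕ} (k : Fin n) (B : Matrix (Fin n) (Fin n) ℤ) :
    mutMat k (-B) = - mutMat k B := by
  ext i j
  simp only [mutMat, Matrix.neg_apply]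
  split_ifs
  · rfl
  · rw [Int.sign_neg, neg_mul_neg]; ring

section flip2
variable {n : ℕ} {L R : ℤ} {B : Matrix (Fin n) (Fin n) ℤ} {p q : Fin n → ℤ}

theorem PInv.mirror (H : PInv L R B p q) :
    PInv (-R) (-L) (-B) (fun j => -q j) (fun j => -p j) where
  dg j := by have := H.dg j; omega
  inj i j h1 h2 := H.inj i j (by simpa using h2) (by simpa using h1)
  nc i j h1 h2 h3 := H.nc j i (by simpa using h3) (by simpa using h2) (by simpa using h1)
  inn k := by
    obtain ⟨t, h1, h2⟩ := H.inn k
    exact ⟨-t, h2.neg, h1.neg⟩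
  out k := by
    obtain ⟨t, ⟨h1, h2⟩ | ⟨h1, h2⟩⟩ := H.out k
    · exact ⟨-t, Or.inr ⟨h1.neg, h2.neg⟩⟩
    · exact ⟨-t, Or.inl ⟨h1.neg, h2.neg⟩⟩
  pos i j h := by
    rw [PPos.neg_iff] at h
    simp [H.neg i j h]
  neg i j h := by
    rw [PPos.neg_iff] at h
    simp [H.pos i j h]
  zer i j h h' := by
    rw [PPos.neg_iff] at h h'
    simp [H.zer i j h' h]

/-- Everything we need to know about a flip. -/
def FlipGood (L R : ℤ) (B : Matrix (Fin n) (Fin n) ℤ) (p q : Fin n → ℤ) (k : Fin n) : Prop :=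
  ∃ p' q' : Fin n → ℤ, PInv L R (mutMat k B) p' q' ∧ (∀ j, j ≠ k → p' j = p j ∧ q' j = q j) ∧
    (∀ p0 q0, (L ≤ p0 ∧ p0 + 2 ≤ q0 ∧ q0 ≤ R ∧ (p0 = L → q0 ≠ R)) →
      cr p0 q0 (p' k) (q' k) + cr p0 q0 (p k) (q k) =
        max (∑ j, ((B j k).toNat : ℤ) * cr p0 q0 (p j) (q j))
          (∑ j, ((-(B j k)).toNat : ℤ) * cr p0 q0 (p j) (q j))) ∧
    (∀ (m : ℕ) (P Q : Fin m → ℤ) (x : Fin m → ℚ), PFam L R P Q →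
      (∀ j, MM P Q x (p' j) (q' j) = 0) → MM P Q x (p k) (q k) = 0)

theorem FlipGood.mirror {k : Fin n}
    (h : FlipGood (-R) (-L) (-B) (fun j => -q j) (fun j => -p j) k) : FlipGood L R B p q k := by
  obtain ⟨p', q', h1, h2, h3, h4⟩ := h
  refine ⟨fun j => -q' j, fun j => -p' j, ?_, ?_, ?_, ?_⟩
  · have := h1.mirror
    rw [mutMat_neg] at this
    simpa using this
  · intro j hj
    have := h2 j hj
    simp [this.1, this.2]
  · intro p0 q0 h0
    have := h3 (-q0) (-p0) (by omega)
    simp only [cr_neg, Matrix.neg_apply, neg_neg] at this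
    rw [max_comm, ← this]
    congr 1
    rw [← @cr_neg p0 q0]
    simp
  · intro m P Q x HP hx
    have := h4 m (fun j => -Q j) (fun j => -P j) x HP.neg (fun j => by
      have := hx j
      rw [← MM_neg] at this
      simpa using this)
    rwa [MM_neg] at this

theorem edge_sum (hinj : ∀ i j, p i = p j → q i = q j → i = j) (F : ℤ → ℤ → ℤ)
    (hF : ∀ a b, (b = a + 1 ∨ (a = L ∧ b = R)) → F a b = 0) {a b : ℤ} (h : PE L R p q a b) :
    ∑ j, (if p j = a ∧ q j = b then 1 else 0) * F (p j) (q j) = F a b := by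
  by_cases h0 : F a b = 0
  · rw [h0]
    refine Finset.sum_eq_zero fun j _ => ?_
    split_ifs with hh
    · rw [hh.1, hh.2, h0]; simp
    · simp
  · obtain ⟨j, rfl, rfl⟩ : ∃ j, p j = a ∧ q j = b := by
      rcases h.2.2.2 with h | h | h
      · exact absurd (hF _ _ (Or.inl h)) h0
      · exact absurd (hF _ _ (Or.inr h)) h0
      · exact h
    rw [Finset.sum_eq_single j]
    · simp
    · intro i _ hi
      rw [if_neg]
      · simp
      · exact fun hh => hi (hinj i j hh.1 hh.2)
    · simp

theorem PInv.flipGood1 (H : PInv L R B p q) (k : Fin n) {w x y z : ℤ}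
    (hk : p k = w) (hk' : q k = y) (h1 : PE L R p q w x) (h2 : PE L R p q x y)
    (h3 : PE L R p q y z) (h4 : PE L R p q w z) : FlipGood L R B p q k := by
  have HF := H.flip1 k hk hk' h1 h2 h3 h4
  have l1 := h1.lt
  have l2 := h2.lt
  have l3 := h3.lt
  refine ⟨_, _, HF, ?_, ?_, ?_⟩
  · intro j hj
    simp [Function.update_of_ne hj]
  · intro p0 q0 h0
    simp only [Function.update_self]
    rw [hk, hk', trop_ptolemy (by omega) l1 l2 l3]
    have hF := fun a b hh => @cr_bdry L R p0 q0 a b h0 hh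
    rw [← edge_sum H.inj (cr p0 q0) hF h1, ← edge_sum H.inj (cr p0 q0) hF h2,
      ← edge_sum H.inj (cr p0 q0) hF h3, ← edge_sum H.inj (cr p0 q0) hF h4,
      ← Finset.sum_add_distrib, ← Finset.sum_add_distrib]
    congr 1
    · refine Finset.sum_congr rfl fun j _ => ?_
      rw [← add_mul]
      congr 1
      have c := H.col k hk hk' h1 h2 h3 h4 j
      by_cases c1 : PPos L R p q j k
      · rw [H.pos j k c1]
        rw [c.1] at c1
        split_ifs <;> first | omega | simp
      · have : (B j k).toNat = 0 := by
          by_cases c2 : PPos L R p q k j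
          · rw [H.neg j k c2]; rfl
          · rw [H.zer j k c1 c2]; rfl
        rw [this]
        rw [c.1] at c1
        split_ifs <;> first | omega | simp
    · refine Finset.sum_congr rfl fun j _ => ?_
      rw [← add_mul]
      congr 1
      have c := H.col k hk hk' h1 h2 h3 h4 j
      by_cases c1 : PPos L R p q k j
      · rw [H.neg j k c1]
        rw [c.2] at c1
        split_ifs <;> first | omega | simp
      · have : (-(B j k)).toNat = 0 := by
          by_cases c2 : PPos L R p q j k
          · rw [H.pos j k c2]; rfl
          · rw [H.zer j k c2 c1]; rfl
        rw [this]
        rw [c.2] at c1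
        split_ifs <;> first | omega | simp
  · intro m P Q X HP hx
    have key : ∀ a b, PE L R p q a b → ¬ (a = w ∧ b = y) → MM P Q X a b = 0 := by
      intro a b hab hne
      rcases hab.2.2.2 with h | h | ⟨j, rfl, rfl⟩
      · exact MM_bdry HP X (Or.inl h)
      · exact MM_bdry HP X (Or.inr h)
      · have hj : j ≠ k := by rintro rfl; exact hne ⟨hk, hk'⟩
        have := hx j
        simpa [Function.update_of_ne hj] using this
    rw [hk, hk']
    have h5 := hx k
    simp only [Function.update_self] at h5
    exact ker_flip HP l1 l2 l3 (key _ _ h1 (by omega)) (key _ _ h2 (by omega))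
      (key _ _ h3 (by omega)) (key _ _ h4 (by omega)) h5

theorem PInv.flipGood (H : PInv L R B p q) (k : Fin n) : FlipGood L R B p q k := by
  obtain ⟨b, hb1, hb2⟩ := H.inn k
  obtain ⟨t, ⟨h1, h2⟩ | ⟨h1, h2⟩⟩ := H.out k
  · exact H.flipGood1 k rfl rfl hb1 hb2 h1 h2
  · exact FlipGood.mirror (H.mirror.flipGood1 k rfl rfl hb2.neg hb1.neg h1.neg h2.neg)

end flip2

/-! ### Matrix facts and the initial triangulation -/

theorem mutMat_mutMat {n : ℕ} (k : Fin n) (B : Matrix (Fin n) (Fin n) ℤ) :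
    mutMat k (mutMat k B) = B := by
  ext i j
  by_cases h : i = k ∨ j = k
  · simp [mutMat, h]
  · simp [mutMat, h]

theorem skew_iff {n : ℕ} {B : Matrix (Fin n) (Fin n) ℤ} {d : Fin n → ℤ} :
    (Matrix.diagonal d * B)ᵀ = -(Matrix.diagonal d * B) ↔ ∀ i j, d i * B i j = -(d j * B j i) := by
  constructor
  · intro h i j
    have := congrFun (congrFun h j) i
    simpa using this
  · intro h
    ext i j
    simpa using h j i

theorem skew_aux {di dj dk a b a' b' : ℤ} (hi : 0 < di) (hj : 0 < dj) (hk : 0 < dk)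
    (h1 : di * a = -(dk * a')) (h2 : dk * b = -(dj * b')) :
    di * (a.sign * max (a * b) 0) = -(dj * (b'.sign * max (b' * a') 0)) := by
  rcases lt_trichotomy a 0 with ha | ha | ha
  · have ha' : 0 < a' := by nlinarith
    rcases lt_trichotomy b 0 with hb | hb | hb
    · have hb' : 0 < b' := by nlinarith
      rw [Int.sign_eq_neg_one_of_neg ha, Int.sign_eq_one_of_pos hb',
        max_eq_left (by nlinarith), max_eq_left (by nlinarith)]
      linear_combination (-b) * h1 + a' * h2
    · have hb' : b' = 0 := by subst hb; nlinarith
      simp [hb, hb']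
    · have hb' : b' < 0 := by nlinarith
      rw [max_eq_right (by nlinarith), max_eq_right (by nlinarith)]
      simp
  · have ha' : a' = 0 := by subst ha; nlinarith
    simp [ha, ha']
  · have ha' : a' < 0 := by nlinarith
    rcases lt_trichotomy b 0 with hb | hb | hb
    · have hb' : 0 < b' := by nlinarith
      rw [max_eq_right (by nlinarith), max_eq_right (by nlinarith)]
      simp
    · have hb' : b' = 0 := by subst hb; nlinarith
      simp [hb, hb']
    · have hb' : b' < 0 := by nlinarith
      rw [Int.sign_eq_neg_one_of_neg hb', Int.sign_eq_one_of_pos ha,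
        max_eq_left (by nlinarith), max_eq_left (by nlinarith)]
      linear_combination b * h1 - a' * h2

theorem SkewSymmetrizable.mut {n : ℕ} {B : Matrix (Fin n) (Fin n) ℤ} (h : SkewSymmetrizable B)
    (k : Fin n) : SkewSymmetrizable (mutMat k B) := by
  obtain ⟨d, hd, h⟩ := h
  rw [skew_iff] at h
  refine ⟨d, hd, skew_iff.2 fun i j => ?_⟩
  by_cases hh : i = k ∨ j = k
  · have hh' := hh.symm
    simp only [mutMat, hh, hh', if_true]
    have := h i j
    linarith
  · have hh' : ¬ (j = k ∨ i = k) := fun h => hh h.symm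
    simp only [mutMat, hh, hh', if_false]
    have := skew_aux (hd i) (hd j) (hd k) (h i k) (h k j)
    have := h i j
    linarith

open Classical in
/-- left endpoints of the snake triangulation -/
def snL (e : ℕ → Prop) : ℕ → ℤ
  | 0 => -1
  | i + 1 => if e i then snL e i - 1 else snL e i

open Classical in
/-- right endpoints of the snake triangulation -/
def snR (e : ℕ → Prop) : ℕ → ℤ
  | 0 => 1
  | i + 1 => if e i then snR e i else snR e i + 1

theorem sn_step (e : ℕ → Prop) (i : ℕ) :
    (e i ∧ snL e (i + 1) = snL e i - 1 ∧ snR e (i + 1) = snR e i) ∨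
    (¬ e i ∧ snL e (i + 1) = snL e i ∧ snR e (i + 1) = snR e i + 1) := by
  by_cases h : e i
  · left; simp [snL, snR, h]
  · right; simp [snL, snR, h]

theorem sn_basic (e : ℕ → Prop) (i : ℕ) :
    snL e i ≤ -1 ∧ 1 ≤ snR e i ∧ snR e i - snL e i = i + 2 := by
  induction i with
  | zero => simp [snL, snR]
  | succ i ih => have := sn_step e i; push_cast; omega

theorem snL_anti (e : ℕ → Prop) : Antitone (snL e) :=
  antitone_nat_of_succ_le fun i => by have := sn_step e i; omega

theorem snR_mono (e : ℕ → Prop) : Monotone (snR e) :=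
  monotone_nat_of_le_succ fun i => by have := sn_step e i; omega

theorem sn_PPos (m : ℕ) (e : ℕ → Prop) (i j : Fin (m + 1)) :
    PPos (snL e m) (snR e m + 1) (fun i : Fin (m + 1) => snL e i) (fun i => snR e i) i j ↔
      (j.val = i.val + 1 ∧ e i) ∨ (i.val = j.val + 1 ∧ ¬ e j) := by
  have bi := sn_basic e i
  have bj := sn_basic e j
  have bm := sn_basic e m
  have li := snL_anti e (Nat.lt_succ_iff.1 i.2)
  have lj := snL_anti e (Nat.lt_succ_iff.1 j.2)
  have ri := snR_mono e (Nat.lt_succ_iff.1 i.2)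
  have rj := snR_mono e (Nat.lt_succ_iff.1 j.2)
  constructor
  · rintro (⟨h, h'⟩ | ⟨h, h'⟩ | ⟨h, h'⟩)
    · simp only at h; omega
    · simp only at h
      left
      have h1 : j.val = i.val + 1 := by
        rcases h'.2.2.2 with g | g | ⟨c, g, g'⟩
        · simp only at g; omega
        · simp only at g; omega
        · have := sn_basic e c
          simp only at g'; omega
      refine ⟨h1, ?_⟩
      have := sn_step e i
      rw [h1] at h
      rcases this with t | t
      · exact t.1
      · omega
    · simp only at h
      right
      have h1 : i.val = j.val + 1 := by
        rcases h'.2.2.2 with g | g | ⟨c, g, g'⟩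
        · simp only at g; omega
        · simp only at g; omega
        · have := sn_basic e c
          simp only at g; omega
      refine ⟨h1, ?_⟩
      have := sn_step e j
      rw [h1] at h
      rcases this with t | t
      · omega
      · exact t.1
  · rintro (⟨h, h'⟩ | ⟨h, h'⟩)
    · right; left
      have := sn_step e i
      rw [← h] at this
      have t : snL e j = snL e i - 1 ∧ snR e j = snR e i := by
        rcases this with t | t
        · exact t.2
        · exact absurd h' t.1
      refine ⟨t.2.symm, lj, ?_, ?_, ?_⟩
      · simp only; omega
      · simp only; omega
      · left; simp only; omega
    · right; right
      have := sn_step e j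
      rw [← h] at this
      have t : snL e i = snL e j ∧ snR e i = snR e j + 1 := by
        rcases this with t | t
        · exact absurd t.1 h'
        · exact t.2
      refine ⟨t.1, ?_, ?_, ?_, ?_⟩
      · simp only; omega
      · simp only; omega
      · simp only; omega
      · left; simp only; omega

theorem snake_PInv (m : ℕ) (C : Matrix (Fin (m + 1)) (Fin (m + 1)) ℤ) (e : ℕ → Prop)
    (h1 : ∀ i j : Fin (m + 1), j.val = i.val + 1 → e i → C i j = 1 ∧ C j i = -1)
    (h2 : ∀ i j : Fin (m + 1), j.val = i.val + 1 → ¬ e i → C i j = -1 ∧ C j i = 1)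
    (h0 : ∀ i j : Fin (m + 1), j.val ≠ i.val + 1 → i.val ≠ j.val + 1 → C i j = 0) :
    PInv (snL e m) (snR e m + 1) C (fun i : Fin (m + 1) => snL e i) (fun i => snR e i) := by
  have bm := sn_basic e m
  have pe : ∀ c : ℕ, c ≤ m → PE (snL e m) (snR e m + 1) (fun i : Fin (m + 1) => snL e i)
      (fun i => snR e i) (snL e c) (snR e c) := by
    intro c hc
    have bc := sn_basic e c
    have lc := snL_anti e hc
    have rc := snR_mono e hc
    exact ⟨lc, by omega, by omega, Or.inr (Or.inr ⟨⟨c, by omega⟩, rfl, rfl⟩)⟩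
  have bd : ∀ a : ℤ, snL e m ≤ a → a ≤ snR e m → PE (snL e m) (snR e m + 1)
      (fun i : Fin (m + 1) => snL e i) (fun i => snR e i) a (a + 1) := by
    intro a ha ha'
    exact ⟨ha, by omega, by omega, Or.inl rfl⟩
  refine ⟨?_, ?_, ?_, ?_, ?_, ?_, ?_, ?_⟩
  · intro j
    have bj := sn_basic e j
    have lj := snL_anti e (Nat.lt_succ_iff.1 j.2)
    have rj := snR_mono e (Nat.lt_succ_iff.1 j.2)
    omega
  · intro i j hi hj
    have bi := sn_basic e i
    have bj := sn_basic e j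
    apply Fin.ext
    omega
  · intro i j hi hj hk
    rcases le_total i.val j.val with h | h
    · have := snL_anti e h; omega
    · have := snR_mono e h; omega
  · rintro ⟨k, hk⟩
    simp only
    rcases k with _ | k
    · have lc := snL_anti e (Nat.zero_le m)
      have rc := snR_mono e (Nat.zero_le m)
      simp only [snL, snR] at lc rc ⊢
      exact ⟨0, bd (-1) lc (by omega), bd 0 (by omega) (by omega)⟩
    · have lk := snL_anti e (show k + 1 ≤ m by omega)
      have rk := snR_mono e (show k + 1 ≤ m by omega)
      have bk := sn_basic e k
      have pk := pe k (by omega)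
      rcases sn_step e k with ⟨_, s1, s2⟩ | ⟨_, s1, s2⟩
      · refine ⟨snL e k, ?_, ?_⟩
        · have := bd (snL e (k + 1)) lk (by omega)
          rw [s1] at this ⊢
          simpa using this
        · rw [s2]; exact pk
      · refine ⟨snR e k, ?_, ?_⟩
        · rw [s1]; exact pk
        · rw [s2]; exact bd _ (by omega) (by omega)
  · rintro ⟨k, hk⟩
    simp only
    by_cases hkm : k = m
    · subst hkm
      refine ⟨snR e k + 1, Or.inl ⟨bd _ (by omega) le_rfl, ?_⟩⟩
      exact ⟨le_rfl, by omega, le_rfl, Or.inr (Or.inl ⟨rfl, rfl⟩)⟩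
    · have lk := snL_anti e (show k + 1 ≤ m by omega)
      have rk := snR_mono e (show k + 1 ≤ m by omega)
      have bk := sn_basic e k
      have pk := pe (k + 1) (by omega)
      rcases sn_step e k with ⟨_, s1, s2⟩ | ⟨_, s1, s2⟩
      · refine ⟨snL e (k + 1), Or.inr ⟨?_, ?_⟩⟩
        · have := bd (snL e (k + 1)) lk (by omega)
          rw [s1] at this ⊢
          simpa using this
        · rw [s2] at pk; exact pk
      · refine ⟨snR e (k + 1), Or.inl ⟨?_, ?_⟩⟩
        · rw [s2]; exact bd _ (by omega) (by omega)
        · rw [s1] at pk; exact pk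
  · intro i j h
    rw [sn_PPos] at h
    rcases h with ⟨h, h'⟩ | ⟨h, h'⟩
    · exact (h1 i j h h').1
    · exact (h2 j i h h').2
  · intro i j h
    rw [sn_PPos] at h
    rcases h with ⟨h, h'⟩ | ⟨h, h'⟩
    · exact (h1 j i h h').2
    · exact (h2 i j h h').1
  · intro i j h h'
    rw [sn_PPos] at h h'
    apply h0
    · intro hh
      by_cases he : e i
      · exact h (Or.inl ⟨hh, he⟩)
      · exact h' (Or.inr ⟨hh, he⟩)
    · intro hh
      by_cases he : e j
      · exact h' (Or.inl ⟨hh, he⟩)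
      · exact h (Or.inr ⟨hh, he⟩)

theorem PE.relabel {n : ℕ} {L R : ℤ} {p q : Fin n → ℤ} (τ : Equiv.Perm (Fin n)) {a b : ℤ} :
    PE L R (fun i => p (τ i)) (fun i => q (τ i)) a b ↔ PE L R p q a b := by
  unfold PE
  have := τ.surjective.exists (p := fun j => p j = a ∧ q j = b)
  rw [this]

theorem PInv.relabel {n : ℕ} {L R : ℤ} {B : Matrix (Fin n) (Fin n) ℤ} {p q : Fin n → ℤ}
    (H : PInv L R B p q) (τ : Equiv.Perm (Fin n)) :
    PInv L R (fun i j => B (τ i) (τ j)) (fun i => p (τ i)) (fun i => q (τ i)) where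
  dg j := H.dg _
  inj i j h h' := τ.injective (H.inj _ _ h h')
  nc i j := H.nc _ _
  inn k := by simp only [PE.relabel]; exact H.inn _
  out k := by simp only [PE.relabel]; exact H.out _
  pos i j h := by
    simp only [PPos, PE.relabel] at h; exact H.pos _ _ h
  neg i j h := by
    simp only [PPos, PE.relabel] at h; exact H.neg _ _ h
  zer i j h h' := by
    simp only [PPos, PE.relabel] at h h'; exact H.zer _ _ h h'

theorem exists_PInv_of_cartan {n : ℕ} (hn : 1 ≤ n) {B : Matrix (Fin n) (Fin n) ℤ}
    (hB : SkewSymmetrizable B) (σ : Equiv.Perm (Fin n))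
    (hσ : ∀ i j, cartanCounterpart B (σ i) (σ j) = cartanA n i j) :
    ∃ L R p q, PInv L R B p q := by
  obtain ⟨m, rfl⟩ : ∃ m, n = m + 1 := ⟨n - 1, by omega⟩
  obtain ⟨d, hd, h⟩ := hB
  rw [skew_iff] at h
  let C : Matrix (Fin (m + 1)) (Fin (m + 1)) ℤ := fun i j => B (σ i) (σ j)
  have hC : ∀ i j, d (σ i) * C i j = -(d (σ j) * C j i) := fun i j => h _ _
  have hadj : ∀ i j, j.val = i.val + 1 → (C i j = 1 ∧ C j i = -1) ∨ (C i j = -1 ∧ C j i = 1) := by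
    intro i j hij
    have hne : i ≠ j := by rintro rfl; omega
    have a1 := hσ i j
    have a2 := hσ j i
    have n1 : σ i ≠ σ j := fun h => hne (σ.injective h)
    simp only [cartanCounterpart, cartanA, if_neg n1, if_neg hne, if_neg n1.symm, if_neg hne.symm,
      hij, true_or, or_true, if_true, neg_inj] at a1 a2
    have a1 : |C i j| = 1 := a1
    have a2 : |C j i| = 1 := a2
    have c := hC i j
    have := hd (σ i)
    have := hd (σ j)
    rcases eq_or_eq_neg_of_abs_eq a1 with a | a <;> rcases eq_or_eq_neg_of_abs_eq a2 with b | b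
    · rw [a, b] at c; omega
    · exact Or.inl ⟨a, b⟩
    · exact Or.inr ⟨a, b⟩
    · rw [a, b] at c; omega
  have hnadj : ∀ i j, j.val ≠ i.val + 1 → i.val ≠ j.val + 1 → C i j = 0 := by
    intro i j g1 g2
    by_cases hne : i = j
    · subst hne
      have c := hC i i
      have := hd (σ i)
      have : d (σ i) * C i i = 0 := by omega
      rcases mul_eq_zero.1 this with h | h
      · omega
      · exact h
    · have a1 := hσ i j
      have n1 : σ i ≠ σ j := fun h => hne (σ.injective h)
      simp only [cartanCounterpart, cartanA, if_neg n1, if_neg hne] at a1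
      rw [if_neg (by omega)] at a1
      have a1 : -|C i j| = 0 := a1
      simpa using a1
  have key := snake_PInv m C (fun i => ∃ a b : Fin (m + 1), a.val = i ∧ b.val = i + 1 ∧ C a b = 1)
    (by
      rintro i j hij ⟨a, b, ha, hb, hab⟩
      obtain rfl : a = i := Fin.ext ha
      obtain rfl : b = j := Fin.ext (by omega)
      rcases hadj a b hij with g | g
      · exact g
      · omega)
    (by
      intro i j hij hh
      rcases hadj i j hij with g | g
      · exact absurd ⟨i, j, rfl, hij, g.1⟩ hh
      · exact g)
    hnadj
  have := key.relabel σ.symm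
  simp only [C, Equiv.apply_symm_apply] at this
  exact ⟨_, _, _, _, this⟩

theorem exists_PInv_initial {n : ℕ} (hn : 1 ≤ n) (B : Matrix (Fin n) (Fin n) ℤ)
    (hB : SkewSymmetrizable B) (htype : PatternOfType (cartanA n) B) :
    ∃ L R p q, PInv L R B p q := by
  obtain ⟨s, hs, σ, hσ⟩ := htype
  have hskew : SkewSymmetrizable s.1 := by
    clear hσ
    unfold IsSeed at hs
    induction hs with
    | refl => exact hB
    | tail _ hbc ih =>
      obtain ⟨k, rfl⟩ := hbc
      exact ih.mut k
  obtain ⟨L, R, h⟩ := exists_PInv_of_cartan hn hskew σ hσ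
  refine ⟨L, R, ?_⟩
  clear hσ hskew
  unfold IsSeed at hs
  induction hs with
  | refl => exact h
  | tail _ hbc ih =>
    obtain ⟨k, rfl⟩ := hbc
    apply ih
    obtain ⟨p, q, H⟩ := h
    obtain ⟨p', q', H', -⟩ := H.flipGood k
    simp only [mutSeed, mutMat_mutMat] at H'
    exact ⟨p', q', H'⟩

/-! ### Orders of vanishing -/

theorem X_dvd_iff_coeff {σ A : Type*} [CommRing A] (i : σ) (f : MvPolynomial σ A) :
    X i ∣ f ↔ ∀ m, m i = 0 → coeff m f = 0 := by
  classical
  constructor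
  · rintro ⟨g, rfl⟩ m hm
    rw [coeff_X_mul', if_neg]
    simpa using hm
  · intro h
    rw [X_dvd_iff_modMonomial_eq_zero]
    ext m
    by_cases hm : Finsupp.single i 1 ≤ m
    · rw [coeff_modMonomial_of_le _ hm]; simp
    · rw [coeff_modMonomial_of_not_le _ hm, h]
      · simp
      · rw [Finsupp.single_le_iff] at hm; omega

/-- polynomials not divisible by `X i` -/
def ndSub (n : ℕ) (i : Fin n) : Submonoid (MvPolynomial (Fin n) ℚ) where
  carrier := {f | ¬ X i ∣ f}
  one_mem' := by
    intro h
    rw [X_dvd_iff_coeff] at h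
    simpa using h 0 rfl
  mul_mem' := by
    intro a b ha hb h
    rcases (X_prime (i := i) (R := ℚ)).dvd_or_dvd h with h | h
    · exact ha h
    · exact hb h

/-- polynomials with nonnegative coefficients not divisible by `X i` -/
def posSub (n : ℕ) (i : Fin n) : Submonoid (MvPolynomial (Fin n) ℚ) where
  carrier := {f | (∀ m, 0 ≤ coeff m f) ∧ ¬ X i ∣ f}
  one_mem' := by
    refine ⟨fun m => ?_, (ndSub n i).one_mem⟩
    rw [coeff_one]
    split_ifs <;> norm_num
  mul_mem' := by
    rintro a b ⟨ha, ha'⟩ ⟨hb, hb'⟩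
    refine ⟨fun m => ?_, (ndSub n i).mul_mem ha' hb'⟩
    rw [coeff_mul]
    exact Finset.sum_nonneg fun x _ => mul_nonneg (ha _) (hb _)

theorem pos_le_nd (n : ℕ) (i : Fin n) : posSub n i ≤ ndSub n i := fun _ h => h.2

theorem nd_ne_zero {n : ℕ} {i : Fin n} {f : MvPolynomial (Fin n) ℚ} (h : f ∈ ndSub n i) : f ≠ 0 := by
  rintro rfl
  exact h (dvd_zero _)

theorem add_mem_pos {n : ℕ} {i : Fin n} {f g : MvPolynomial (Fin n) ℚ} (hf : f ∈ posSub n i)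
    (hg : ∀ m, 0 ≤ coeff m g) : f + g ∈ posSub n i := by
  refine ⟨fun m => ?_, fun h => hf.2 ?_⟩
  · rw [coeff_add]; exact add_nonneg (hf.1 m) (hg m)
  · rw [X_dvd_iff_coeff] at h ⊢
    intro m hm
    have := h m hm
    rw [coeff_add] at this
    have a := hf.1 m
    have b := hg m
    linarith

/-- `y = P / Q * u_i^(-d)` with `P, Q` in the monoid `S` -/
def HasOrd {n : ℕ} (S : Submonoid (MvPolynomial (Fin n) ℚ)) (i : Fin n) (y : CAField n) (d : ℤ) :
    Prop :=
  ∃ P ∈ S, ∃ Q ∈ S, y = algebraMap _ (CAField n) P / algebraMap _ (CAField n) Q * uVar n i ^ (-d)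

section ord
variable {n : ℕ} {S : Submonoid (MvPolynomial (Fin n) ℚ)} {i : Fin n} {y y' : CAField n} {d d' : ℤ}

theorem uVar_ne (i : Fin n) : uVar n i ≠ 0 := by
  unfold uVar
  simp

theorem HasOrd.mono {T : Submonoid (MvPolynomial (Fin n) ℚ)} (hST : S ≤ T) (h : HasOrd S i y d) :
    HasOrd T i y d := by
  obtain ⟨P, hP, Q, hQ, e⟩ := h
  exact ⟨P, hST hP, Q, hST hQ, e⟩

theorem HasOrd.one : HasOrd S i 1 0 := ⟨1, S.one_mem, 1, S.one_mem, by simp⟩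

theorem HasOrd.mul (h : HasOrd S i y d) (h' : HasOrd S i y' d') :
    HasOrd S i (y * y') (d + d') := by
  obtain ⟨P, hP, Q, hQ, rfl⟩ := h
  obtain ⟨P', hP', Q', hQ', rfl⟩ := h'
  refine ⟨P * P', S.mul_mem hP hP', Q * Q', S.mul_mem hQ hQ', ?_⟩
  rw [neg_add, zpow_add₀ (uVar_ne i), map_mul, map_mul, mul_div_mul_comm]
  ring

theorem HasOrd.inv (h : HasOrd S i y d) : HasOrd S i y⁻¹ (-d) := by
  obtain ⟨P, hP, Q, hQ, rfl⟩ := h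
  refine ⟨Q, hQ, P, hP, ?_⟩
  rw [mul_inv, inv_div, ← _root_.zpow_neg]

theorem HasOrd.div (h : HasOrd S i y d) (h' : HasOrd S i y' d') :
    HasOrd S i (y / y') (d - d') := by
  rw [div_eq_mul_inv, sub_eq_add_neg]
  exact h.mul h'.inv

theorem HasOrd.pow (h : HasOrd S i y d) (e : ℕ) : HasOrd S i (y ^ e) (e * d) := by
  induction e with
  | zero => simpa using HasOrd.one
  | succ e ih =>
    rw [pow_succ]
    have := ih.mul h
    convert this using 1
    push_cast
    ring

theorem HasOrd.zpow (h : HasOrd S i y d) (e : ℤ) : HasOrd S i (y ^ e) (e * d) := by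
  rcases e with e | e
  · simpa using h.pow e
  · have := (h.pow (e + 1)).inv
    rw [Int.negSucc_eq, neg_mul, _root_.zpow_neg]
    exact_mod_cast this

theorem HasOrd.prod {ι : Type*} (s : Finset ι) {y : ι → CAField n} {d : ι → ℤ}
    (h : ∀ j, HasOrd S i (y j) (d j)) : HasOrd S i (∏ j ∈ s, y j) (∑ j ∈ s, d j) := by
  classical
  induction s using Finset.induction_on with
  | empty => simpa using HasOrd.one
  | insert a s ha ih =>
    rw [Finset.prod_insert ha, Finset.sum_insert ha]
    exact (h a).mul ih

theorem HasOrd.add_aux (h : HasOrd (posSub n i) i y d) (h' : HasOrd (posSub n i) i y' d')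
    (hd : d' ≤ d) : HasOrd (posSub n i) i (y + y') d := by
  obtain ⟨P, hP, Q, hQ, rfl⟩ := h
  obtain ⟨P', hP', Q', hQ', rfl⟩ := h'
  obtain ⟨e, rfl⟩ : ∃ e : ℕ, d = d' + e := ⟨(d - d').toNat, by omega⟩
  refine ⟨P * Q' + X i ^ e * (P' * Q), add_mem_pos (mul_mem hP hQ') ?_, Q * Q', mul_mem hQ hQ', ?_⟩
  · intro m
    rw [coeff_mul]
    refine Finset.sum_nonneg fun x _ => mul_nonneg ?_ ((mul_mem hP' hQ).1 _)
    rw [coeff_X_pow]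
    split_ifs <;> norm_num
  · have a : algebraMap _ (CAField n) Q ≠ 0 := by simpa using nd_ne_zero hQ.2
    have b : algebraMap _ (CAField n) Q' ≠ 0 := by simpa using nd_ne_zero hQ'.2
    have c := uVar_ne i
    have e1 : uVar n i ^ (-d') = uVar n i ^ (-(d' + e)) * uVar n i ^ e := by
      rw [← zpow_natCast, ← zpow_add₀ c]
      congr 1
      ring
    rw [e1]
    simp only [map_add, map_mul, map_pow]
    have : algebraMap (MvPolynomial (Fin n) ℚ) (CAField n) (X i) = uVar n i := rfl
    rw [this]
    field_simp

theorem HasOrd.add (h : HasOrd (posSub n i) i y d) (h' : HasOrd (posSub n i) i y' d') :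
    HasOrd (posSub n i) i (y + y') (max d d') := by
  rcases le_total d' d with hd | hd
  · rw [max_eq_left hd]; exact h.add_aux h' hd
  · rw [max_eq_right hd, add_comm]; exact h'.add_aux h hd

theorem HasOrd.unique_aux (h : HasOrd (ndSub n i) i y d) (h' : HasOrd (ndSub n i) i y d') :
    d ≤ d' := by
  by_contra hlt
  obtain ⟨P, hP, Q, hQ, e1⟩ := h
  obtain ⟨P', hP', Q', hQ', e2⟩ := h'
  obtain ⟨e, rfl⟩ : ∃ e : ℕ, d = d' + (e + 1) := ⟨(d - d' - 1).toNat, by omega⟩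
  have a : algebraMap _ (CAField n) Q ≠ 0 := by simpa using nd_ne_zero hQ
  have b : algebraMap _ (CAField n) Q' ≠ 0 := by simpa using nd_ne_zero hQ'
  have c := uVar_ne i
  have e3 : uVar n i ^ (-d') = uVar n i ^ (-(d' + (e + 1))) * uVar n i ^ (e + 1) := by
    rw [← zpow_natCast, ← zpow_add₀ c]
    congr 1
    push_cast
    ring
  rw [e1, e3] at e2
  have z := zpow_ne_zero (-(d' + (e + 1))) c
  have key : algebraMap _ (CAField n) (P * Q') =
      algebraMap _ (CAField n) (X i ^ (e + 1) * (P' * Q)) := by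
    simp only [map_mul, map_pow]
    have : algebraMap (MvPolynomial (Fin n) ℚ) (CAField n) (X i) = uVar n i := rfl
    rw [this]
    have e4 : algebraMap _ (CAField n) P / algebraMap _ (CAField n) Q =
        algebraMap _ (CAField n) P' / algebraMap _ (CAField n) Q' * uVar n i ^ (e + 1) := by
      apply mul_right_cancel₀ z
      rw [e2]
      ring
    rw [div_mul_eq_mul_div, div_eq_div_iff a b] at e4
    rw [e4]
    ring
  have key := IsFractionRing.injective (MvPolynomial (Fin n) ℚ) (CAField n) key
  apply (ndSub n i).mul_mem hP hQ'
  rw [key]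
  exact Dvd.dvd.mul_right (dvd_pow_self _ (by omega)) _

theorem HasOrd.unique (h : HasOrd (ndSub n i) i y d) (h' : HasOrd (ndSub n i) i y d') : d = d' :=
  le_antisymm (h.unique_aux h') (h'.unique_aux h)

theorem X_mem_pos {j : Fin n} (hj : j ≠ i) : (X j : MvPolynomial (Fin n) ℚ) ∈ posSub n i := by
  refine ⟨fun m => ?_, fun h => ?_⟩
  · rw [coeff_X']
    split_ifs <;> norm_num
  · rw [X_dvd_X] at h
    exact hj h.symm

theorem HasOrd.var (i j : Fin n) : HasOrd (posSub n i) i (uVar n j) (if j = i then -1 else 0) := by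
  split_ifs with h
  · subst h
    exact ⟨1, one_mem _, 1, one_mem _, by simp⟩
  · exact ⟨X j, X_mem_pos h, 1, one_mem _, by simp [uVar]⟩

theorem aeval_uVar (f : MvPolynomial (Fin n) ℤ) :
    aeval (uVar n) f =
      algebraMap (MvPolynomial (Fin n) ℚ) (CAField n) (map (Int.castRingHom ℚ) f) := by
  have : (aeval (uVar n) : MvPolynomial (Fin n) ℤ →ₐ[ℤ] CAField n).toRingHom =
      (algebraMap (MvPolynomial (Fin n) ℚ) (CAField n)).comp (map (Int.castRingHom ℚ)) := by
    apply MvPolynomial.ringHom_ext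
    · intro r; simp
    · intro j; simp [uVar]
  exact congrArg (fun g : MvPolynomial (Fin n) ℤ →+* CAField n => g f) this

theorem HasOrd.of_denom {d : Fin n → ℤ} (h : IsDenomVec (uVar n) y d) (i : Fin n) :
    HasOrd (ndSub n i) i y (d i) := by
  obtain ⟨f, hf, rfl⟩ := h
  have h1 : HasOrd (ndSub n i) i (aeval (uVar n) f) 0 := by
    refine ⟨map (Int.castRingHom ℚ) f, ?_, 1, one_mem _, by rw [aeval_uVar]; simp⟩
    intro hdvd
    apply hf i
    rw [X_dvd_iff_coeff] at hdvd ⊢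
    intro m hm
    have := hdvd m hm
    rw [coeff_map] at this
    simpa using this
  have h2 := HasOrd.prod Finset.univ
    (fun j => ((HasOrd.var i j).mono (pos_le_nd n i)).zpow (d j))
  have := h1.div h2
  convert this using 1
  simp

end ord

/-! ### The main induction -/

theorem PInv.fam {n : ℕ} {L R : ℤ} {B : Matrix (Fin n) (Fin n) ℤ} {p q : Fin n → ℤ}
    (H : PInv L R B p q) : PFam L R p q := ⟨H.dg, H.inj, H.nc⟩

theorem cr_self {n : ℕ} {L R : ℤ} {p q : Fin n → ℤ} (H : PFam L R p q) (i j : Fin n) :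
    cr (p i) (q i) (p j) (q j) = if j = i then -1 else 0 := by
  by_cases h : j = i
  · subst h; simp [cr]
  · rw [if_neg h]
    have d1 := H.dg i
    have d2 := H.dg j
    have n1 : ¬ (p i < p j ∧ p j < q i ∧ q i < q j) := fun h => H.nc i j h.1 h.2.1 h.2.2
    have n2 : ¬ (p j < p i ∧ p i < q j ∧ q j < q i) := fun h => H.nc j i h.1 h.2.1 h.2.2
    unfold cr
    rw [if_neg, if_neg]
    · omega
    · exact fun hh => h (H.inj j i hh.1 hh.2)

theorem main_inv {n : ℕ} {L R : ℤ} {B : Matrix (Fin n) (Fin n) ℤ} {p0 q0 : Fin n → ℤ}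
    (H0 : PInv L R B p0 q0) (s : Matrix (Fin n) (Fin n) ℤ × (Fin n → CAField n))
    (hs : IsSeed B s) :
    ∃ p q, PInv L R s.1 p q ∧
      (∀ i j, HasOrd (posSub n i) i (s.2 j) (cr (p0 i) (q0 i) (p j) (q j))) ∧
      (∀ x : Fin n → ℚ, (∀ j, MM p0 q0 x (p j) (q j) = 0) → x = 0) := by
  unfold IsSeed at hs
  induction hs with
  | refl =>
    refine ⟨p0, q0, H0, ?_, ?_⟩
    · intro i j
      rw [cr_self H0.fam]
      exact HasOrd.var i j
    · intro x hx
      ext j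
      have := hx j
      simp only [MM, cr_self H0.fam] at this
      simpa using this
  | tail _ hbc ih =>
    rename_i b c _
    obtain ⟨k, rfl⟩ := hbc
    obtain ⟨p, q, H, ho, hk⟩ := ih
    obtain ⟨p', q', H', hj, ht, hm⟩ := H.flipGood k
    refine ⟨p', q', H', ?_, ?_⟩
    · intro i j
      by_cases hjk : j = k
      · subst hjk
        have t := ht (p0 i) (q0 i) (H0.dg i)
        have t' := eq_sub_of_add_eq t
        rw [t']
        simp only [mutSeed, Function.update_self]
        exact ((HasOrd.prod _ fun l => (ho i l).pow _).add
          (HasOrd.prod _ fun l => (ho i l).pow _)).div (ho i j)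
      · simp only [mutSeed, Function.update_of_ne hjk]
        rw [(hj j hjk).1, (hj j hjk).2]
        exact ho i j
    · intro x hx
      apply hk
      intro j
      by_cases hjk : j = k
      · subst hjk
        exact hm n p0 q0 x H0.fam hx
      · rw [← (hj j hjk).1, ← (hj j hjk).2]
        exact hx j

/-- In a cluster pattern of type `A_n` (`n ≥ 1`), the denominator vectors
(with respect to the initial cluster) of the cluster variables of any cluster
are linearly independent over `ℚ`. -/
theorem denominators_linearly_independent_type_A {n : ℕ} (hn : 1 ≤ n)
    (B : Matrix (Fin n) (Fin n) ℤ) (hB : SkewSymmetrizable B)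
    (htype : PatternOfType (cartanA n) B)
    (s : Matrix (Fin n) (Fin n) ℤ × (Fin n → CAField n)) (hs : IsSeed B s)
    (d : Fin n → Fin n → ℤ) (hd : ∀ j, IsDenomVec (uVar n) (s.2 j) (d j)) :
    LinearIndependent ℚ (fun j : Fin n => fun i : Fin n => (d j i : ℚ)) := by
  obtain ⟨L, R, p0, q0, H0⟩ := exists_PInv_initial hn B hB htype
  obtain ⟨p, q, -, ho, hk⟩ := main_inv H0 s hs
  have hdc : ∀ j i, d j i = cr (p0 i) (q0 i) (p j) (q j) := fun j i =>
    (HasOrd.of_denom (hd j) i).unique ((ho i j).mono (pos_le_nd n i))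
  let M : Matrix (Fin n) (Fin n) ℚ := Matrix.of fun j i => (d j i : ℚ)
  have hM : M.det ≠ 0 := by
    intro h0
    obtain ⟨v, hv, hv'⟩ := Matrix.exists_mulVec_eq_zero_iff.2 h0
    apply hv
    apply hk
    intro j
    have := congrFun hv' j
    simp only [Matrix.mulVec, dotProduct, M, Matrix.of_apply, Pi.zero_apply, hdc] at this
    unfold MM
    rw [← this]
    exact Finset.sum_congr rfl fun i _ => mul_comm _ _
  exact Matrix.linearIndependent_rows_of_det_ne_zero hM
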